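/- arXiv:2010.15375 — 2 statements merged into one kernel-verified Lean document; each statement's English description precedes it below -/
import Mathlib

section
/- For every ε ∈ (0,1) and every y0 ∈ Y, the weak* closed convex hull of the set of discounted occupational measures equals the set of discounted stationary measures: cl co Θ_ε(y0) = W(ε,y0). -/
open MeasureTheory Filter Set Topology
open scoped ENNReal NNReal

noncomputable section

namespace StochLP

/-- The model of the controlled stochastic discrete time system (controlled stochastic
recursion) `y(t+1) = f(y(t), u(t), s(t))` from the paper: `Y ⊂ ℝⁿ` is a compact forward
invariant state constraint set, `Uc` is a compact metric control space, `S` is a Polish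
noise space, `U` is an upper semicontinuous compact valued control constraint
multifunction (upper semicontinuity of a compact valued map into a compact space being
recorded as closedness of its graph), `f` is bounded, continuous in `(y,u)` and Borel
measurable in `s`, and `ν` is the common law of the i.i.d. noise elements `s(t)`. -/
structure Model (n : ℕ) (Uc S : Type) [MetricSpace Uc] [CompactSpace Uc]
    [MeasurableSpace Uc] [BorelSpace Uc] [TopologicalSpace S] [PolishSpace S]
    [MeasurableSpace S] [BorelSpace S] where
  Y : Set (Fin n → ℝ)
  U : (Fin n → ℝ) → Set Uc
  f : (Fin n → ℝ) → Uc → S → (Fin n → ℝ)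
  ν : Measure S
  ν_prob : IsProbabilityMeasure ν
  Y_compact : IsCompact Y
  Y_nonempty : Y.Nonempty
  U_nonempty : ∀ y ∈ Y, (U y).Nonempty
  U_compact : ∀ y ∈ Y, IsCompact (U y)
  graph_closed : IsClosed {p : (Fin n → ℝ) × Uc | p.1 ∈ Y ∧ p.2 ∈ U p.1}
  f_bounded : ∃ C : ℝ, ∀ y ∈ Y, ∀ (u : Uc) (s : S), ‖f y u s‖ ≤ C
  f_cont : ∀ s : S, ContinuousOn (fun p : (Fin n → ℝ) × Uc => f p.1 p.2 s) (Y ×ˢ univ)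
  f_meas : ∀ y ∈ Y, ∀ u : Uc, Measurable fun s => f y u s
  f_inv : ∀ y ∈ Y, ∀ u ∈ U y, ∀ s : S, f y u s ∈ Y

variable {n : ℕ} {Uc S : Type} [MetricSpace Uc] [CompactSpace Uc] [MeasurableSpace Uc]
  [BorelSpace Uc] [TopologicalSpace S] [PolishSpace S] [MeasurableSpace S] [BorelSpace S]

/-- A control plan: a sequence of Borel measurable selections of the multifunction `U`. -/
structure Plan (M : Model n Uc S) where
  π : ℕ → (Fin n → ℝ) → Uc
  measurable : ∀ t, Measurable (π t)
  feasible : ∀ t, ∀ y ∈ M.Y, π t y ∈ M.U y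

/-- The law of the state `y^{π,y₀}(t)` of the controlled stochastic recursion started at
`y₀` and driven by the i.i.d. noise with common law `ν`, defined by the Markov recursion.  -/
def stateLaw (M : Model n Uc S) (t : ℕ) :
    (ℕ → (Fin n → ℝ) → Uc) → (Fin n → ℝ) → Measure (Fin n → ℝ) :=
  Nat.rec (motive := fun _ => (ℕ → (Fin n → ℝ) → Uc) → (Fin n → ℝ) → Measure (Fin n → ℝ))
    (fun _ y => Measure.dirac y)
    (fun _ ih π y =>
      (M.ν.map fun s => M.f y (π 0 y) s).bind fun y' => ih (fun j => π (j + 1)) y') t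

/-- The joint law of the state-control pair `(y^{π,y₀}(t), u^{π,y₀}(t))`. -/
def saLaw (M : Model n Uc S) (t : ℕ) (π : ℕ → (Fin n → ℝ) → Uc) (y0 : Fin n → ℝ) :
    Measure ((Fin n → ℝ) × Uc) :=
  (stateLaw M t π y0).map fun z => (z, π t z)

/-- `E[q(y^{π,y₀}(t), u^{π,y₀}(t))]`. -/
def expSA (M : Model n Uc S) (t : ℕ) (π : ℕ → (Fin n → ℝ) → Uc) (y0 : Fin n → ℝ)
    (q : (Fin n → ℝ) → Uc → ℝ) : ℝ :=
  ∫ p, q p.1 p.2 ∂saLaw M t π y0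

/-- The finite horizon average expected cost `(1/T) E[Σ_{t=0}^{T-1} k(y(t),u(t))]`. -/
def costT (M : Model n Uc S) (k : (Fin n → ℝ) → Uc → ℝ) (T : ℕ) (π : ℕ → (Fin n → ℝ) → Uc)
    (y0 : Fin n → ℝ) : ℝ :=
  (1 / (T : ℝ)) * ∑ t ∈ Finset.range T, expSA M t π y0 k

/-- The optimal value `v_T(y₀)` of the finite horizon problem. -/
def vT (M : Model n Uc S) (k : (Fin n → ℝ) → Uc → ℝ) (T : ℕ) (y0 : Fin n → ℝ) : ℝ :=
  ⨅ π : Plan M, costT M k T π.π y0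

/-- The expected discounted cost `ε Σ_{t=0}^∞ (1-ε)^t E[k(y(t),u(t))]`. -/
def costDisc (M : Model n Uc S) (k : (Fin n → ℝ) → Uc → ℝ) (ε : ℝ)
    (π : ℕ → (Fin n → ℝ) → Uc) (y0 : Fin n → ℝ) : ℝ :=
  ε * ∑' t : ℕ, (1 - ε) ^ t * expSA M t π y0 k

/-- The optimal value `h_ε(y₀)` of the discounted problem. -/
def hEps (M : Model n Uc S) (k : (Fin n → ℝ) → Uc → ℝ) (ε : ℝ) (y0 : Fin n → ℝ) : ℝ :=
  ⨅ π : Plan M, costDisc M k ε π.π y0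

/-- The graph `G` of the multifunction `U`. -/
def graphG (M : Model n Uc S) : Set ((Fin n → ℝ) × Uc) := {p | p.1 ∈ M.Y ∧ p.2 ∈ M.U p.1}

/-- `E[φ(f(y,u,s))]`, the expectation over the noise of `φ` evaluated after one step. -/
def Ef (M : Model n Uc S) (φ : (Fin n → ℝ) → ℝ) (y : Fin n → ℝ) (u : Uc) : ℝ :=
  ∫ s, φ (M.f y u s) ∂M.ν

/-- A measure on `Y × Uc` is concentrated on the graph `G` (this encodes measures defined
on Borel subsets of `G`). -/
def onG (M : Model n Uc S) (γ : Measure ((Fin n → ℝ) × Uc)) : Prop := γ (graphG M)ᶜ = 0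

/-- The set `W` of stationary measures. -/
def Wset (M : Model n Uc S) : Set (Measure ((Fin n → ℝ) × Uc)) :=
  {γ | IsProbabilityMeasure γ ∧ onG M γ ∧
    ∀ φ : (Fin n → ℝ) → ℝ, Continuous φ → ∫ p, (Ef M φ p.1 p.2 - φ p.1) ∂γ = 0}

/-- The set `W(ε, y₀)` of discounted stationary measures. -/
def Weps (M : Model n Uc S) (ε : ℝ) (y0 : Fin n → ℝ) : Set (Measure ((Fin n → ℝ) × Uc)) :=
  {γ | IsProbabilityMeasure γ ∧ onG M γ ∧
    ∀ φ : (Fin n → ℝ) → ℝ, Continuous φ →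
      ∫ p, ((1 - ε) * (Ef M φ p.1 p.2 - φ p.1) + ε * (φ y0 - φ p.1)) ∂γ = 0}

/-- The optimal value `k*(ε, y₀)` of the IDLP problem over `W(ε, y₀)`. -/
def kStarEps (M : Model n Uc S) (k : (Fin n → ℝ) → Uc → ℝ) (ε : ℝ) (y0 : Fin n → ℝ) : ℝ :=
  sInf ((fun γ : Measure ((Fin n → ℝ) × Uc) => ∫ p, k p.1 p.2 ∂γ) '' Weps M ε y0)

/-- The optimal value `k*` of the IDLP problem over `W`. -/
def kStar (M : Model n Uc S) (k : (Fin n → ℝ) → Uc → ℝ) : ℝ :=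
  sInf ((fun γ : Measure ((Fin n → ℝ) × Uc) => ∫ p, k p.1 p.2 ∂γ) '' Wset M)

/-- The optimal value `μ*(ε, y₀)` of the problem dual to the IDLP problem over `W(ε,y₀)`. -/
def muStarEps (M : Model n Uc S) (k : (Fin n → ℝ) → Uc → ℝ) (ε : ℝ) (y0 : Fin n → ℝ) : ℝ :=
  sSup {r : ℝ | ∃ ψ : (Fin n → ℝ) → ℝ, Continuous ψ ∧
    r = sInf ((fun p : (Fin n → ℝ) × Uc =>
      k p.1 p.2 + (1 - ε) * (Ef M ψ p.1 p.2 - ψ p.1) + ε * (ψ y0 - ψ p.1)) '' graphG M)}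

/-- The optimal value `μ*` of the problem dual to the IDLP problem over `W`. -/
def muStar (M : Model n Uc S) (k : (Fin n → ℝ) → Uc → ℝ) : ℝ :=
  sSup {r : ℝ | ∃ ψ : (Fin n → ℝ) → ℝ, Continuous ψ ∧
    r = sInf ((fun p : (Fin n → ℝ) × Uc => k p.1 p.2 + Ef M ψ p.1 p.2 - ψ p.1) '' graphG M)}

/-- The feasible set `Ω(y₀)` of the augmented IDLP problem. -/
def OmegaSet (M : Model n Uc S) (y0 : Fin n → ℝ) :
    Set (Measure ((Fin n → ℝ) × Uc) × Measure ((Fin n → ℝ) × Uc)) :=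
  {p | p.1 ∈ Wset M ∧ IsFiniteMeasure p.2 ∧ onG M p.2 ∧
    ∀ φ : (Fin n → ℝ) → ℝ, Continuous φ →
      ∫ q, (φ y0 - φ q.1) ∂p.1 + ∫ q, (Ef M φ q.1 q.2 - φ q.1) ∂p.2 = 0}

/-- The optimal value `k*(y₀)` of the augmented IDLP problem. -/
def kStarAug (M : Model n Uc S) (k : (Fin n → ℝ) → Uc → ℝ) (y0 : Fin n → ℝ) : ℝ :=
  sInf ((fun p : Measure ((Fin n → ℝ) × Uc) × Measure ((Fin n → ℝ) × Uc) =>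
    ∫ q, k q.1 q.2 ∂p.1) '' OmegaSet M y0)

/-- Feasibility of `(μ, ψ, η)` for the problem dual to the augmented IDLP problem. -/
def DualFeas (M : Model n Uc S) (k : (Fin n → ℝ) → Uc → ℝ) (y0 : Fin n → ℝ)
    (ψ η : (Fin n → ℝ) → ℝ) (μ : ℝ) : Prop :=
  (∀ p ∈ graphG M, 0 ≤ k p.1 p.2 + (ψ y0 - ψ p.1) + Ef M η p.1 p.2 - η p.1 - μ) ∧
  (∀ p ∈ graphG M, 0 ≤ Ef M ψ p.1 p.2 - ψ p.1)

/-- The optimal value `d*(y₀)` of the dual (with continuous test functions) of the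
augmented IDLP problem. -/
def dStar (M : Model n Uc S) (k : (Fin n → ℝ) → Uc → ℝ) (y0 : Fin n → ℝ) : ℝ :=
  sSup {μ : ℝ | ∃ ψ η : (Fin n → ℝ) → ℝ, Continuous ψ ∧ Continuous η ∧
    DualFeas M k y0 ψ η μ}

/-- Bounded Borel measurable real valued functions. -/
def BddBorel (ψ : (Fin n → ℝ) → ℝ) : Prop := Measurable ψ ∧ ∃ C : ℝ, ∀ y, |ψ y| ≤ C

/-- The optimal value `d̂*(y₀)` of the relaxed dual (with bounded Borel test functions) of
the augmented IDLP problem. -/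
def dHatStar (M : Model n Uc S) (k : (Fin n → ℝ) → Uc → ℝ) (y0 : Fin n → ℝ) : ℝ :=
  sSup {μ : ℝ | ∃ ψ η : (Fin n → ℝ) → ℝ, BddBorel ψ ∧ BddBorel η ∧ DualFeas M k y0 ψ η μ}

/-- The occupational measure `γ^{π,y₀,T}`. -/
def occT (M : Model n Uc S) (T : ℕ) (π : ℕ → (Fin n → ℝ) → Uc) (y0 : Fin n → ℝ) :
    Measure ((Fin n → ℝ) × Uc) :=
  (T : ℝ≥0∞)⁻¹ • ∑ t ∈ Finset.range T, saLaw M t π y0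

/-- The discounted occupational measure `γ_d^{π,y₀,ε}`. -/
def discOcc (M : Model n Uc S) (ε : ℝ) (π : ℕ → (Fin n → ℝ) → Uc) (y0 : Fin n → ℝ) :
    Measure ((Fin n → ℝ) × Uc) :=
  ENNReal.ofReal ε • Measure.sum fun t : ℕ => ENNReal.ofReal (1 - ε) ^ t • saLaw M t π y0

/-- The set `Θ_ε(y₀)` of discounted occupational measures, as a set of probability
measures (carrying the topology of weak convergence). -/
def ThetaEps (M : Model n Uc S) (ε : ℝ) (y0 : Fin n → ℝ) :
    Set (ProbabilityMeasure ((Fin n → ℝ) × Uc)) :=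
  {μ | ∃ π : Plan M, μ.toMeasure = discOcc M ε π.π y0}

/-- `Θ_ε := ∪_{y₀ ∈ Y} Θ_ε(y₀)`. -/
def ThetaEpsAll (M : Model n Uc S) (ε : ℝ) : Set (ProbabilityMeasure ((Fin n → ℝ) × Uc)) :=
  ⋃ y0 ∈ M.Y, ThetaEps M ε y0

/-- The set `Γ_T(y₀)` of occupational measures. -/
def GammaT (M : Model n Uc S) (T : ℕ) (y0 : Fin n → ℝ) :
    Set (ProbabilityMeasure ((Fin n → ℝ) × Uc)) :=
  {μ | ∃ π : Plan M, μ.toMeasure = occT M T π.π y0}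

/-- `Γ_T := ∪_{y₀ ∈ Y} Γ_T(y₀)`. -/
def GammaTAll (M : Model n Uc S) (T : ℕ) : Set (ProbabilityMeasure ((Fin n → ℝ) × Uc)) :=
  ⋃ y0 ∈ M.Y, GammaT M T y0

/-- `W` as a set of probability measures. -/
def WsetPM (M : Model n Uc S) : Set (ProbabilityMeasure ((Fin n → ℝ) × Uc)) :=
  {μ | μ.toMeasure ∈ Wset M}

/-- `W(ε,y₀)` as a set of probability measures. -/
def WepsPM (M : Model n Uc S) (ε : ℝ) (y0 : Fin n → ℝ) :
    Set (ProbabilityMeasure ((Fin n → ℝ) × Uc)) :=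
  {μ | μ.toMeasure ∈ Weps M ε y0}

/-- The set of finite convex combinations of elements of a set of probability measures,
i.e. its convex hull. -/
def convexCombos {α : Type*} [MeasurableSpace α] (A : Set (ProbabilityMeasure α)) :
    Set (ProbabilityMeasure α) :=
  {μ | ∃ (m : ℕ) (w : Fin m → ℝ≥0) (γ : Fin m → ProbabilityMeasure α),
    (∀ i, γ i ∈ A) ∧ (∑ i, w i) = 1 ∧
    μ.toMeasure = ∑ i, (w i : ℝ≥0∞) • (γ i).toMeasure}

/-- Membership in the set `D₁(y₀)`. -/
def D1mem (M : Model n Uc S) (y0 : Fin n → ℝ) (γ : Measure ((Fin n → ℝ) × Uc)) : Prop :=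
  ∃ ξ : ℕ → Measure ((Fin n → ℝ) × Uc),
    (∀ l, IsFiniteMeasure (ξ l) ∧ onG M (ξ l)) ∧
    ∀ φ : (Fin n → ℝ) → ℝ, Continuous φ →
      Tendsto (fun l => ∫ q, (Ef M φ q.1 q.2 - φ q.1) ∂ξ l) atTop
        (𝓝 (∫ q, (φ q.1 - φ y0) ∂γ))

/-- A control plan is periodic regime generating (PRG) for the initial point `y₀`. -/
def IsPRG (M : Model n Uc S) (π : Plan M) (y0 : Fin n → ℝ) : Prop :=
  ∃ T0 Tp : ℕ, 0 < Tp ∧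
    ∀ q : ((Fin n → ℝ) × Uc) → ℝ, Continuous q →
      ∀ t, T0 ≤ t → ∫ p, q p ∂saLaw M t π.π y0 = ∫ p, q p ∂saLaw M (t + Tp) π.π y0

/-- The optimal value `V_per(y₀)` over periodic regime generating control plans. -/
def Vper (M : Model n Uc S) (k : (Fin n → ℝ) → Uc → ℝ) (y0 : Fin n → ℝ) : ℝ :=
  sInf {c : ℝ | ∃ π : Plan M, IsPRG M π y0 ∧
    Tendsto (fun T => costT M k T π.π y0) atTop (𝓝 c)}

/-- The optimal value `k*_θ(y₀)` of the perturbed augmented IDLP problem. -/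
def kStarTheta (M : Model n Uc S) (k θ : (Fin n → ℝ) → Uc → ℝ) (y0 : Fin n → ℝ) : ℝ :=
  sInf ((fun p : Measure ((Fin n → ℝ) × Uc) × Measure ((Fin n → ℝ) × Uc) =>
    ∫ q, k q.1 q.2 ∂p.1 + ∫ q, θ q.1 q.2 ∂p.2) '' OmegaSet M y0)

/-- Feasibility of `(μ, ψ, η)` for the perturbed dual problem. -/
def DualFeasTheta (M : Model n Uc S) (k θ : (Fin n → ℝ) → Uc → ℝ) (y0 : Fin n → ℝ)
    (ψ η : (Fin n → ℝ) → ℝ) (μ : ℝ) : Prop :=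
  (∀ p ∈ graphG M, 0 ≤ k p.1 p.2 + (ψ y0 - ψ p.1) + Ef M η p.1 p.2 - η p.1 - μ) ∧
  (∀ p ∈ graphG M, -θ p.1 p.2 ≤ Ef M ψ p.1 p.2 - ψ p.1)

/-- The optimal value `d*_θ(y₀)` of the perturbed dual problem. -/
def dStarTheta (M : Model n Uc S) (k θ : (Fin n → ℝ) → Uc → ℝ) (y0 : Fin n → ℝ) : ℝ :=
  sSup {μ : ℝ | ∃ ψ η : (Fin n → ℝ) → ℝ, Continuous ψ ∧ Continuous η ∧
    DualFeasTheta M k θ y0 ψ η μ}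

/-- The optimal value `d̄*_θ(y₀)` of the second form of the perturbed dual problem. -/
def dBarTheta (M : Model n Uc S) (k θ : (Fin n → ℝ) → Uc → ℝ) (y0 : Fin n → ℝ) : ℝ :=
  sSup {r : ℝ | ∃ ψ η : (Fin n → ℝ) → ℝ, Continuous ψ ∧ Continuous η ∧ r = ψ y0 ∧
    (∀ p ∈ graphG M, 0 ≤ k p.1 p.2 - ψ p.1 + Ef M η p.1 p.2 - η p.1) ∧
    (∀ p ∈ graphG M, -θ p.1 p.2 ≤ Ef M ψ p.1 p.2 - ψ p.1)}

section Selection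

variable {α K : Type*} [MeasurableSpace α] [MetricSpace K]

/-- A closed-valued multifunction with nonempty values which is measurable, in the sense that the
set of points whose value meets a given closed set is measurable. -/
structure IsMeasurableMultifunction (D : α → Set K) : Prop where
  nonempty : ∀ a, (D a).Nonempty
  isClosed : ∀ a, IsClosed (D a)
  measurableSet : ∀ F : Set K, IsClosed F → MeasurableSet {a | (D a ∩ F).Nonempty}

theorem IsMeasurableMultifunction.exists_subset_dist_le [Nonempty K]
    [TopologicalSpace.SeparableSpace K] {D : α → Set K}
    (hD : IsMeasurableMultifunction D) {r : ℝ} (hr : 0 < r) :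
    ∃ D' : α → Set K, IsMeasurableMultifunction D' ∧ (∀ a, D' a ⊆ D a) ∧
      ∀ a, ∀ x ∈ D' a, ∀ y ∈ D' a, dist x y ≤ 2 * r := by
  classical
  let c := TopologicalSpace.denseSeq K
  have hex : ∀ a, ∃ i, (D a ∩ Metric.closedBall (c i) r).Nonempty := by
    intro a
    obtain ⟨x, hx⟩ := hD.nonempty a
    obtain ⟨i, hi⟩ := (TopologicalSpace.denseRange_denseSeq K).exists_dist_lt x hr
    exact ⟨i, x, hx, hi.le⟩
  have hball : ∀ i, MeasurableSet {a | (D a ∩ Metric.closedBall (c i) r).Nonempty} :=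
    fun i => hD.measurableSet _ Metric.isClosed_closedBall
  have hfind : Measurable fun a => Nat.find (hex a) := measurable_find hex hball
  refine ⟨fun a => D a ∩ Metric.closedBall (c (Nat.find (hex a))) r,
    ⟨fun a => Nat.find_spec (hex a), fun a => (hD.isClosed a).inter Metric.isClosed_closedBall,
      fun F hF => ?_⟩, fun a => inter_subset_left, fun a x hx y hy => ?_⟩
  · have : {a | (D a ∩ Metric.closedBall (c (Nat.find (hex a))) r ∩ F).Nonempty} =
        ⋃ i, ((fun a => Nat.find (hex a)) ⁻¹' {i} ∩
          {a | (D a ∩ (Metric.closedBall (c i) r ∩ F)).Nonempty}) := by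
      ext a
      simp [inter_assoc]
    rw [this]
    exact MeasurableSet.iUnion fun i => (hfind (measurableSet_singleton i)).inter
      (hD.measurableSet _ (Metric.isClosed_closedBall.inter hF))
  · have h1 := hx.2
    have h2 := hy.2
    rw [Metric.mem_closedBall] at h1 h2
    linarith [dist_triangle_right x y (c (Nat.find (hex a)))]

/-- A closed-valued measurable multifunction into a compact metric space has a measurable
selection. -/
theorem IsMeasurableMultifunction.exists_measurable_selection [CompactSpace K]
    [Nonempty K] [MeasurableSpace K] [BorelSpace K]
    {D : α → Set K} (hD : IsMeasurableMultifunction D) :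
    ∃ g : α → K, Measurable g ∧ ∀ a, g a ∈ D a := by
  have hstep : ∀ (k : ℕ) (E : {E : α → Set K // IsMeasurableMultifunction E}),
      ∃ E' : {E : α → Set K // IsMeasurableMultifunction E}, (∀ a, E'.1 a ⊆ E.1 a) ∧
        ∀ a, ∀ x ∈ E'.1 a, ∀ y ∈ E'.1 a, dist x y ≤ 2 * (1 / 2 : ℝ) ^ k := by
    intro k E
    obtain ⟨E', h1, h2, h3⟩ :=
      E.2.exists_subset_dist_le (r := (1 / 2 : ℝ) ^ k) (by positivity)
    exact ⟨⟨E', h1⟩, h2, h3⟩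
  choose next hsub hdist using hstep
  let E : ℕ → {E : α → Set K // IsMeasurableMultifunction E} :=
    fun k => Nat.rec ⟨D, hD⟩ (fun k E => next k E) k
  have hanti : ∀ a, Antitone fun k => (E k).1 a :=
    fun a => antitone_nat_of_succ_le fun k => hsub k (E k) a
  have hcompact : ∀ (F : Set K), IsClosed F → ∀ a, (∀ k, ((E k).1 a ∩ F).Nonempty) →
      (⋂ k, ((E k).1 a ∩ F)).Nonempty := fun F hF a h =>
    IsCompact.nonempty_iInter_of_sequence_nonempty_isCompact_isClosed _
      (fun k => inter_subset_inter_left _ (hanti a k.le_succ)) h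
      (((E 0).2.isClosed a).inter hF).isCompact (fun k => ((E k).2.isClosed a).inter hF)
  have hne : ∀ a, ∃ x, ∀ k, x ∈ (E k).1 a := by
    intro a
    obtain ⟨x, hx⟩ := hcompact univ isClosed_univ a
      (fun k => by simpa using (E k).2.nonempty a)
    exact ⟨x, fun k => (mem_iInter.1 hx k).1⟩
  choose g hg using hne
  have huniq : ∀ a x, (∀ k, x ∈ (E k).1 a) → x = g a := by
    intro a x hx
    have hlim : Tendsto (fun k : ℕ => 2 * (1 / 2 : ℝ) ^ k) atTop (𝓝 (2 * 0)) :=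
      (tendsto_pow_atTop_nhds_zero_of_lt_one (by norm_num) (by norm_num)).const_mul 2
    have hle : dist x (g a) ≤ 2 * 0 := ge_of_tendsto' hlim fun k =>
      hdist k (E k) a x (hx (k + 1)) (g a) (hg a (k + 1))
    exact dist_le_zero.1 (by simpa using hle)
  refine ⟨g, measurable_of_isClosed fun F hF => ?_, fun a => hg a 0⟩
  have : g ⁻¹' F = ⋂ k, {a | ((E k).1 a ∩ F).Nonempty} := by
    ext a
    simp only [mem_preimage, mem_iInter, mem_ofPred_eq]
    refine ⟨fun h k => ⟨g a, hg a k, h⟩, fun h => ?_⟩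
    obtain ⟨x, hx⟩ := hcompact F hF a h
    rw [mem_iInter] at hx
    rw [← huniq a x fun k => (hx k).1]
    exact (hx 0).2
  rw [this]
  exact MeasurableSet.iInter fun k => (E k).2.measurableSet F hF

theorem exists_eq_iInf_of_lowerSemicontinuous {L : Type*} [TopologicalSpace L]
    [CompactSpace L] [Nonempty L] {q : L → ℝ≥0∞} (hq : LowerSemicontinuous q) :
    ∃ u, q u = ⨅ v, q v := by
  obtain ⟨u, -, hu⟩ := (hq.lowerSemicontinuousOn univ).exists_isMinOn univ_nonempty isCompact_univ
  exact ⟨u, le_antisymm (le_iInf fun v => hu (mem_univ v)) (iInf_le _ u)⟩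

/-- Partial minimization of a lower semicontinuous function over a compact variable. -/
theorem lowerSemicontinuous_iInf_snd {X L : Type*} [TopologicalSpace X] [TopologicalSpace L]
    [CompactSpace L] [Nonempty L] {Q : X × L → ℝ≥0∞} (hQ : LowerSemicontinuous Q) :
    LowerSemicontinuous fun x => ⨅ u, Q (x, u) := by
  rw [lowerSemicontinuous_iff_isClosed_preimage]
  intro c
  convert isClosedMap_fst_of_compactSpace _ (lowerSemicontinuous_iff_isClosed_preimage.1 hQ c)
    using 1
  ext x
  obtain ⟨u, hu⟩ := exists_eq_iInf_of_lowerSemicontinuous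
    (hQ.comp (Continuous.prodMk_right x))
  simp only [mem_preimage, mem_Iic, mem_image, Prod.exists, exists_and_right, exists_eq_right]
  exact ⟨fun h => ⟨u, hu.trans_le h⟩, fun ⟨v, hv⟩ => (iInf_le _ v).trans hv⟩

/-- Measurable selection of minimizers. -/
theorem exists_measurable_argmin {X : Type*} [TopologicalSpace X] [MeasurableSpace X]
    [OpensMeasurableSpace X] [CompactSpace K] [Nonempty K] [MeasurableSpace K]
    [BorelSpace K] {Q : X × K → ℝ≥0∞} (hQ : LowerSemicontinuous Q) :
    ∃ g : X → K, Measurable g ∧ ∀ x, Q (x, g x) ≤ ⨅ u, Q (x, u) := by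
  refine IsMeasurableMultifunction.exists_measurable_selection
    (D := fun x => {u | Q (x, u) ≤ ⨅ v, Q (x, v)}) ⟨fun x => ?_, fun x => ?_, fun F hF => ?_⟩
  · obtain ⟨u, hu⟩ := exists_eq_iInf_of_lowerSemicontinuous (hQ.comp (Continuous.prodMk_right x))
    exact ⟨u, hu.le⟩
  · exact lowerSemicontinuous_iff_isClosed_preimage.1 (hQ.comp (Continuous.prodMk_right x)) _
  · rcases F.eq_empty_or_nonempty with rfl | hne
    · simp
    have : Nonempty F := hne.to_subtype
    have : CompactSpace F := isCompact_iff_compactSpace.1 hF.isCompact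
    have hQF : LowerSemicontinuous fun p : X × F => Q (p.1, p.2) :=
      hQ.comp (by fun_prop : Continuous fun p : X × F => (p.1, (p.2 : K)))
    convert measurableSet_le (lowerSemicontinuous_iInf_snd hQF).measurable
      (lowerSemicontinuous_iInf_snd hQ).measurable using 1
    ext x
    obtain ⟨u, hu⟩ := exists_eq_iInf_of_lowerSemicontinuous (hQF.comp (Continuous.prodMk_right x))
    constructor
    · rintro ⟨v, hv, hvF⟩
      exact (iInf_le (fun w : F => Q (x, w)) ⟨v, hvF⟩).trans hv
    · exact fun h => ⟨u, hu.trans_le h, u.2⟩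

end Selection

section Transition

open ProbabilityTheory

variable (M : Model n Uc S)

theorem measurable_uncurry_f :
    Measurable fun q : (M.Y × Uc) × S => M.f q.1.1 q.1.2 q.2 := by
  refine measurable_uncurry_of_continuous_of_measurable
    (u := fun (p : M.Y × Uc) (s : S) => M.f p.1 p.2 s) (fun s => ?_) fun p => M.f_meas _ p.1.2 _
  exact (M.f_cont s).comp_continuous
    (by fun_prop : Continuous fun p : M.Y × Uc => ((p.1 : Fin n → ℝ), p.2))
    fun p => ⟨p.1.2, mem_univ _⟩

open Classical in
/-- The recursion map, extended arbitrarily (but measurably) outside the state space. -/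
def stepMap (q : ((Fin n → ℝ) × Uc) × S) : Fin n → ℝ :=
  if q.1.1 ∈ M.Y then M.f q.1.1 q.1.2 q.2 else q.1.1

theorem measurable_stepMap : Measurable (stepMap M) := by
  classical
  have hY : MeasurableSet M.Y := M.Y_compact.measurableSet
  have hs : MeasurableSet {q : ((Fin n → ℝ) × Uc) × S | q.1.1 ∈ M.Y} :=
    (measurable_fst.comp measurable_fst) hY
  refine measurable_of_restrict_of_restrict_compl hs ?_ ?_
  · have : ({q | q.1.1 ∈ M.Y}.domRestrict (stepMap M)) =
        (fun q : (M.Y × Uc) × S => M.f q.1.1 q.1.2 q.2) ∘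
          fun q : {q : ((Fin n → ℝ) × Uc) × S | q.1.1 ∈ M.Y} =>
            ((⟨q.1.1.1, q.2⟩, q.1.1.2), q.1.2) := by
      ext1 q
      exact if_pos q.2
    rw [this]
    exact (measurable_uncurry_f M).comp (by fun_prop)
  · have : ({q | q.1.1 ∈ M.Y}ᶜ.domRestrict (stepMap M)) =
        fun q : ↥{q : ((Fin n → ℝ) × Uc) × S | q.1.1 ∈ M.Y}ᶜ => q.1.1.1 := by
      ext1 q
      exact if_neg q.2
    rw [this]
    fun_prop

/-- The controlled transition kernel. -/
def transition : Kernel ((Fin n → ℝ) × Uc) (Fin n → ℝ) where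
  toFun p := M.ν.map fun s => stepMap M (p, s)
  measurable' := by
    have := M.ν_prob
    refine Measure.measurable_of_measurable_coe _ fun A hA => ?_
    have := measurable_measure_prodMk_left (ν := M.ν) (measurable_stepMap M hA)
    convert this using 2 with p
    rw [Measure.map_apply (by exact (measurable_stepMap M).comp measurable_prodMk_left) hA]
    rfl

theorem transition_apply (p : (Fin n → ℝ) × Uc) (hp : p.1 ∈ M.Y) :
    transition M p = M.ν.map fun s => M.f p.1 p.2 s := by
  change M.ν.map (fun s => stepMap M (p, s)) = _
  simp [stepMap, hp]

instance : IsMarkovKernel (transition M) := by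
  have := M.ν_prob
  exact ⟨fun p => Measure.isProbabilityMeasure_map
    ((measurable_stepMap M).comp measurable_prodMk_left).aemeasurable⟩

theorem transition_ae_mem {p : (Fin n → ℝ) × Uc} (hp : p ∈ graphG M) :
    ∀ᵐ y ∂transition M p, y ∈ M.Y := by
  rw [transition_apply M p hp.1, ae_map_iff (p := fun y => y ∈ M.Y)
    (M.f_meas _ hp.1 _).aemeasurable M.Y_compact.measurableSet]
  exact .of_forall fun s => M.f_inv _ hp.1 _ hp.2 s

theorem lintegral_transition {p : (Fin n → ℝ) × Uc} (hp : p.1 ∈ M.Y)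
    {V : (Fin n → ℝ) → ℝ≥0∞} (hV : Measurable V) :
    ∫⁻ y, V y ∂transition M p = ∫⁻ s, V (M.f p.1 p.2 s) ∂M.ν := by
  rw [transition_apply M p hp, lintegral_map hV (M.f_meas _ hp _)]

theorem integral_transition {p : (Fin n → ℝ) × Uc} (hp : p.1 ∈ M.Y)
    {φ : (Fin n → ℝ) → ℝ} (hφ : Continuous φ) :
    ∫ y, φ y ∂transition M p = Ef M φ p.1 p.2 := by
  rw [transition_apply M p hp, integral_map (M.f_meas _ hp _).aemeasurable
    hφ.measurable.aestronglyMeasurable, Ef]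

variable {M}

/-- The plan followed after the first step. -/
def Plan.tail (π : Plan M) : Plan M where
  π t := π.π (t + 1)
  measurable t := π.measurable (t + 1)
  feasible t := π.feasible (t + 1)

/-- The one step transition kernel of the state under the decision rule used at time `t`. -/
def Plan.step (π : Plan M) (t : ℕ) : Kernel (Fin n → ℝ) (Fin n → ℝ) :=
  (transition M).comap (fun y => (y, π.π t y)) (measurable_id.prodMk (π.measurable t))

instance (π : Plan M) (t : ℕ) : IsMarkovKernel (π.step t) := by
  unfold Plan.step; infer_instance

/-- The `t` step transition kernel of the state under a plan. -/
def planKernel : ℕ → Plan M → Kernel (Fin n → ℝ) (Fin n → ℝ)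
  | 0, _ => Kernel.id
  | t + 1, π => planKernel t π.tail ∘ₖ π.step 0

instance isMarkovKernel_planKernel (t : ℕ) (π : Plan M) : IsMarkovKernel (planKernel t π) := by
  induction t generalizing π with
  | zero => unfold planKernel; infer_instance
  | succ t ih =>
    have := ih π.tail
    unfold planKernel; infer_instance

theorem planKernel_succ (t : ℕ) (π : Plan M) :
    planKernel (t + 1) π = π.step t ∘ₖ planKernel t π := by
  induction t generalizing π with
  | zero => simp [planKernel]
  | succ t ih =>
    rw [planKernel, ih, planKernel, Kernel.comp_assoc]
    rfl

theorem Plan.step_ae_mem (π : Plan M) (t : ℕ) {y : Fin n → ℝ} (hy : y ∈ M.Y) :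
    ∀ᵐ z ∂π.step t y, z ∈ M.Y :=
  transition_ae_mem M ⟨hy, π.feasible t y hy⟩

theorem planKernel_ae_mem (t : ℕ) (π : Plan M) {y : Fin n → ℝ} (hy : y ∈ M.Y) :
    ∀ᵐ z ∂planKernel t π y, z ∈ M.Y := by
  have hY : MeasurableSet M.Y := M.Y_compact.measurableSet
  induction t generalizing π y with
  | zero =>
    rw [planKernel, Kernel.id_apply, ae_dirac_iff (p := fun y => y ∈ M.Y) hY]
    exact hy
  | succ t ih =>
    rw [planKernel, Kernel.comp_apply, Measure.ae_comp_iff (p := fun y => y ∈ M.Y) hY]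
    filter_upwards [π.step_ae_mem 0 hy] with z hz using ih π.tail hz

theorem stateLaw_eq_planKernel (t : ℕ) (π : Plan M) {y : Fin n → ℝ} (hy : y ∈ M.Y) :
    stateLaw M t π.π y = planKernel t π y := by
  induction t generalizing π y with
  | zero => simp [planKernel, Kernel.id_apply, stateLaw]
  | succ t ih =>
    rw [planKernel, Kernel.comp_apply]
    have h0 : π.step 0 y = M.ν.map fun s => M.f y (π.π 0 y) s := transition_apply M (y, _) hy
    change (M.ν.map fun s => M.f y (π.π 0 y) s).bind (fun y' => stateLaw M t π.tail.π y') = _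
    rw [← h0]
    refine Measure.bind_congr_right ?_
    filter_upwards [π.step_ae_mem 0 hy] with z hz using ih π.tail hz

end Transition

section Balance

open ProbabilityTheory

variable (M : Model n Uc S)

theorem isClosed_graphG : IsClosed (graphG M) := M.graph_closed

theorem isCompact_graphG : IsCompact (graphG M) :=
  (M.Y_compact.prod isCompact_univ).of_isClosed_subset (isClosed_graphG M)
    fun _ hp => ⟨hp.1, mem_univ _⟩

theorem onG_iff_ae {γ : Measure ((Fin n → ℝ) × Uc)} : onG M γ ↔ ∀ᵐ p ∂γ, p ∈ graphG M :=
  Iff.rfl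

/-- The flow balance equation characterizing discounted stationary measures, tested against
nonnegative measurable functions. -/
def Balanced (ε : ℝ) (y0 : Fin n → ℝ) (γ : Measure ((Fin n → ℝ) × Uc)) : Prop :=
  ∀ V : (Fin n → ℝ) → ℝ≥0∞, Measurable V →
    ∫⁻ p, V p.1 ∂γ = ENNReal.ofReal (1 - ε) * ∫⁻ p, ∫⁻ y, V y ∂transition M p ∂γ +
      ENNReal.ofReal ε * V y0

theorem balanced_iff_map_fst_eq {ε : ℝ} {y0 : Fin n → ℝ} {γ : Measure ((Fin n → ℝ) × Uc)} :
    Balanced M ε y0 γ ↔ γ.map Prod.fst =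
      ENNReal.ofReal (1 - ε) • (transition M ∘ₘ γ) + ENNReal.ofReal ε • Measure.dirac y0 := by
  have key : ∀ V : (Fin n → ℝ) → ℝ≥0∞, Measurable V →
      ∫⁻ y, V y ∂(ENNReal.ofReal (1 - ε) • (transition M ∘ₘ γ) +
        ENNReal.ofReal ε • Measure.dirac y0) =
      ENNReal.ofReal (1 - ε) * ∫⁻ p, ∫⁻ y, V y ∂transition M p ∂γ + ENNReal.ofReal ε * V y0 := by
    intro V hV
    rw [lintegral_add_measure, lintegral_smul_measure, lintegral_smul_measure,
      Measure.lintegral_bind (Kernel.aemeasurable _) hV.aemeasurable, lintegral_dirac' _ hV]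
    rfl
  constructor
  · refine fun h => Measure.ext_of_lintegral _ fun V hV => ?_
    rw [lintegral_map hV measurable_fst, h V hV, key V hV]
  · intro h V hV
    rw [← key V hV, ← h, lintegral_map hV measurable_fst]

theorem transition_comp_ae_mem {γ : Measure ((Fin n → ℝ) × Uc)} (hγ : onG M γ) :
    ∀ᵐ y ∂(transition M ∘ₘ γ), y ∈ M.Y := by
  rw [Measure.ae_comp_iff (p := fun y => y ∈ M.Y) M.Y_compact.measurableSet]
  filter_upwards [(onG_iff_ae M).1 hγ] with p hp using transition_ae_mem M hp

theorem map_fst_ae_mem {γ : Measure ((Fin n → ℝ) × Uc)} (hγ : onG M γ) :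
    ∀ᵐ y ∂γ.map Prod.fst, y ∈ M.Y := by
  rw [ae_map_iff (p := fun y => y ∈ M.Y) measurable_fst.aemeasurable M.Y_compact.measurableSet]
  filter_upwards [(onG_iff_ae M).1 hγ] with p hp using hp.1

theorem integrable_of_ae_mem {φ : (Fin n → ℝ) → ℝ} (hφ : Continuous φ)
    {μ : Measure (Fin n → ℝ)} [IsFiniteMeasure μ] (hμ : ∀ᵐ y ∂μ, y ∈ M.Y) : Integrable φ μ := by
  obtain ⟨C, hC⟩ := M.Y_compact.exists_bound_of_continuousOn hφ.continuousOn
  refine Integrable.of_bound hφ.measurable.aestronglyMeasurable C ?_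
  filter_upwards [hμ] with y hy using hC y hy

theorem integral_balance {ε : ℝ} {y0 : Fin n → ℝ} {γ : Measure ((Fin n → ℝ) × Uc)}
    [IsProbabilityMeasure γ] (hγ : onG M γ) {φ : (Fin n → ℝ) → ℝ} (hφ : Continuous φ) :
    ∫ p, ((1 - ε) * (Ef M φ p.1 p.2 - φ p.1) + ε * (φ y0 - φ p.1)) ∂γ =
      (1 - ε) * ∫ y, φ y ∂(transition M ∘ₘ γ) + ε * φ y0 - ∫ y, φ y ∂γ.map Prod.fst := by
  have h1 := integrable_of_ae_mem M hφ (transition_comp_ae_mem M hγ)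
  have h2 := integrable_of_ae_mem M hφ (map_fst_ae_mem M hγ)
  have h3 : Integrable (fun p => ∫ y, φ y ∂transition M p) γ := by
    rw [Measure.comp_eq_comp_const_apply] at h1
    simpa using h1.integral_comp
  have h4 : Integrable (fun p : (Fin n → ℝ) × Uc => φ p.1) γ := h2.comp_measurable measurable_fst
  have h6 : ∫ y, φ y ∂(transition M ∘ₘ γ) = ∫ p, ∫ y, φ y ∂transition M p ∂γ := by
    rw [Measure.comp_eq_comp_const_apply] at h1 ⊢
    simpa using Kernel.integral_comp h1
  rw [integral_map measurable_fst.aemeasurable hφ.measurable.aestronglyMeasurable, h6]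
  have h5 : ∫ p, ((1 - ε) * (Ef M φ p.1 p.2 - φ p.1) + ε * (φ y0 - φ p.1)) ∂γ =
      ∫ p, ((1 - ε) * ∫ y, φ y ∂transition M p) + ε * φ y0 - φ p.1 ∂γ := by
    refine integral_congr_ae ?_
    filter_upwards [(onG_iff_ae M).1 hγ] with p hp
    rw [integral_transition M hp.1 hφ]
    ring
  have h7 : Integrable (fun p => ((1 - ε) * ∫ y, φ y ∂transition M p) + ε * φ y0) γ :=
    (h3.const_mul _).add (integrable_const _)
  rw [h5, integral_sub h7 h4, integral_add (h3.const_mul _) (integrable_const _),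
    integral_const_mul]
  simp

theorem mem_Weps_iff_balanced {ε : ℝ} (hε : ε ∈ Set.Ioo (0 : ℝ) 1) {y0 : Fin n → ℝ}
    {γ : Measure ((Fin n → ℝ) × Uc)} :
    γ ∈ Weps M ε y0 ↔ IsProbabilityMeasure γ ∧ onG M γ ∧ Balanced M ε y0 γ := by
  refine and_congr_right fun hprob => and_congr_right fun hγ => ?_
  have hrhs : ∀ φ : (Fin n → ℝ) → ℝ, Continuous φ →
      ∫ y, φ y ∂(ENNReal.ofReal (1 - ε) • (transition M ∘ₘ γ) +
        ENNReal.ofReal ε • Measure.dirac y0) =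
      (1 - ε) * ∫ y, φ y ∂(transition M ∘ₘ γ) + ε * φ y0 := by
    intro φ hφ
    have h1 := integrable_of_ae_mem M hφ (transition_comp_ae_mem M hγ)
    rw [integral_add_measure (h1.smul_measure ENNReal.ofReal_ne_top)
      ((integrable_dirac (by finiteness)).smul_measure ENNReal.ofReal_ne_top),
      integral_smul_measure, integral_smul_measure, integral_dirac,
      ENNReal.toReal_ofReal (by linarith [hε.2]), ENNReal.toReal_ofReal hε.1.le]
    rfl
  rw [balanced_iff_map_fst_eq]
  constructor
  · intro h
    have : IsFiniteMeasure (ENNReal.ofReal (1 - ε) • (transition M ∘ₘ γ)) :=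
      Measure.smul_finite _ ENNReal.ofReal_ne_top
    have : IsFiniteMeasure (ENNReal.ofReal ε • Measure.dirac y0) :=
      Measure.smul_finite _ ENNReal.ofReal_ne_top
    refine ext_of_forall_integral_eq_of_IsFiniteMeasure fun φ => ?_
    rw [hrhs φ φ.continuous]
    have := h φ φ.continuous
    rw [integral_balance M hγ φ.continuous] at this
    linarith
  · intro h φ hφ
    rw [integral_balance M hγ hφ, h, hrhs φ hφ, sub_self]

theorem continuousOn_Ef {φ : (Fin n → ℝ) → ℝ} (hφ : Continuous φ) :
    ContinuousOn (fun p : (Fin n → ℝ) × Uc => Ef M φ p.1 p.2) (graphG M) := by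
  have := M.ν_prob
  obtain ⟨C, hC⟩ := M.Y_compact.exists_bound_of_continuousOn hφ.continuousOn
  refine continuousOn_of_dominated (bound := fun _ => C) (fun p hp => ?_) (fun p hp => ?_)
    (integrable_const C) (.of_forall fun s => ?_)
  · exact (hφ.measurable.comp (M.f_meas _ hp.1 _)).aestronglyMeasurable
  · exact .of_forall fun s => hC _ (M.f_inv _ hp.1 _ hp.2 s)
  · exact hφ.comp_continuousOn ((M.f_cont s).mono fun p hp => ⟨hp.1, mem_univ _⟩)

theorem isClosed_setOf_onG :
    IsClosed {γ : ProbabilityMeasure ((Fin n → ℝ) × Uc) | onG M γ.toMeasure} := by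
  refine isClosed_iff_forall_filter.2 fun γ F hF hle hlim => ?_
  have h := ProbabilityMeasure.le_liminf_measure_open_of_tendsto (μs := id) hlim
    (isClosed_graphG M).isOpen_compl
  refine le_antisymm (h.trans ?_) zero_le
  have h0 : ∀ᶠ μ in F, (id μ : ProbabilityMeasure ((Fin n → ℝ) × Uc)).toMeasure (graphG M)ᶜ = 0 :=
    le_principal_iff.1 hle
  rw [liminf_congr h0]
  simp

/-- On measures concentrated on the graph, integration against a function continuous on the graph
is integration against a bounded continuous function. -/
theorem exists_boundedContinuous_integral_eq {h : (Fin n → ℝ) × Uc → ℝ}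
    (hh : ContinuousOn h (graphG M)) :
    ∃ q : BoundedContinuousFunction ((Fin n → ℝ) × Uc) ℝ,
      ∀ γ : Measure ((Fin n → ℝ) × Uc), onG M γ → ∫ p, h p ∂γ = ∫ p, q p ∂γ := by
  have := isCompact_iff_compactSpace.1 (isCompact_graphG M)
  obtain ⟨q, -, hq⟩ := BoundedContinuousFunction.exists_norm_eq_domRestrict_eq_of_closed
    (BoundedContinuousFunction.mkOfCompact ⟨_, hh.domRestrict⟩) (isClosed_graphG M)
  refine ⟨q, fun γ hγ => integral_congr_ae ?_⟩
  filter_upwards [(onG_iff_ae M).1 hγ] with p hp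
  exact (DFunLike.congr_fun hq ⟨p, hp⟩).symm

theorem isClosed_WepsPM (ε : ℝ) (y0 : Fin n → ℝ) : IsClosed (WepsPM M ε y0) := by
  have hφ : ∀ φ : (Fin n → ℝ) → ℝ, Continuous φ →
      ∃ q : BoundedContinuousFunction ((Fin n → ℝ) × Uc) ℝ,
        ∀ γ : Measure ((Fin n → ℝ) × Uc), onG M γ →
          ∫ p, ((1 - ε) * (Ef M φ p.1 p.2 - φ p.1) + ε * (φ y0 - φ p.1)) ∂γ = ∫ p, q p ∂γ := by
    intro φ hφ
    refine exists_boundedContinuous_integral_eq M ?_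
    have := continuousOn_Ef M hφ
    have h2 : ContinuousOn (fun p : (Fin n → ℝ) × Uc => φ p.1) (graphG M) :=
      (hφ.comp continuous_fst).continuousOn
    fun_prop
  choose! q hq using hφ
  have : WepsPM M ε y0 = {γ | onG M γ.toMeasure} ∩
      ⋂ (φ : (Fin n → ℝ) → ℝ) (_ : Continuous φ),
        {γ : ProbabilityMeasure ((Fin n → ℝ) × Uc) | ∫ p, q φ p ∂γ.toMeasure = 0} := by
    ext γ
    simp only [WepsPM, Weps, mem_ofPred_eq, mem_inter_iff, mem_iInter]
    have : IsProbabilityMeasure γ.toMeasure := inferInstance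
    simp only [this, true_and]
    refine and_congr_right fun hγ => forall₂_congr fun φ hφ => ?_
    rw [hq φ hφ _ hγ]
  rw [this]
  refine (isClosed_setOf_onG M).inter (isClosed_iInter fun φ => isClosed_iInter fun _ => ?_)
  exact isClosed_eq
    (ProbabilityMeasure.continuous_integral_boundedContinuousFunction (q φ)) continuous_const

end Balance

section Occupational

open ProbabilityTheory

variable {M : Model n Uc S} {ε : ℝ}

theorem ofReal_add_ofReal_one_sub (hε : ε ∈ Set.Ioo (0 : ℝ) 1) :
    ENNReal.ofReal ε + ENNReal.ofReal (1 - ε) = 1 := by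
  rw [← ENNReal.ofReal_add hε.1.le (by linarith [hε.2])]
  simp

theorem ofReal_mul_tsum_geometric (hε : ε ∈ Set.Ioo (0 : ℝ) 1) :
    ENNReal.ofReal ε * ∑' t : ℕ, ENNReal.ofReal (1 - ε) ^ t = 1 := by
  rw [ENNReal.tsum_geometric, ← ofReal_add_ofReal_one_sub hε,
    ENNReal.add_sub_cancel_right ENNReal.ofReal_ne_top, ENNReal.mul_inv_cancel _ (by simp),
    ofReal_add_ofReal_one_sub hε]
  simpa using hε.1

theorem lintegral_discOcc (π : Plan M) {y0 : Fin n → ℝ} (hy0 : y0 ∈ M.Y)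
    {k : (Fin n → ℝ) × Uc → ℝ≥0∞} (hk : Measurable k) :
    ∫⁻ p, k p ∂discOcc M ε π.π y0 = ENNReal.ofReal ε *
      ∑' t : ℕ, ENNReal.ofReal (1 - ε) ^ t * ∫⁻ z, k (z, π.π t z) ∂planKernel t π y0 := by
  simp only [discOcc, saLaw, lintegral_smul_measure, lintegral_sum_measure, smul_eq_mul]
  congr 2 with t
  rw [lintegral_map hk (measurable_id'.prodMk (π.measurable t)), stateLaw_eq_planKernel t π hy0]

theorem onG_discOcc (π : Plan M) {y0 : Fin n → ℝ} (hy0 : y0 ∈ M.Y) :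
    onG M (discOcc M ε π.π y0) := by
  have hG : MeasurableSet (graphG M)ᶜ := (isClosed_graphG M).measurableSet.compl
  rw [onG, ← lintegral_indicator_one hG, lintegral_discOcc π hy0 (measurable_one.indicator hG)]
  have : ∀ t, ∫⁻ z, (graphG M)ᶜ.indicator 1 (z, π.π t z) ∂planKernel t π y0 = 0 := by
    intro t
    rw [← lintegral_zero (μ := planKernel t π y0)]
    refine lintegral_congr_ae ?_
    filter_upwards [planKernel_ae_mem t π hy0] with z hz
    exact indicator_of_notMem (not_not.2 ⟨hz, π.feasible t z hz⟩) _
  simp [this]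

theorem isProbabilityMeasure_discOcc (hε : ε ∈ Set.Ioo (0 : ℝ) 1) (π : Plan M)
    {y0 : Fin n → ℝ} (hy0 : y0 ∈ M.Y) : IsProbabilityMeasure (discOcc M ε π.π y0) := by
  constructor
  rw [← lintegral_one, lintegral_discOcc π hy0 measurable_const]
  simpa using ofReal_mul_tsum_geometric hε

theorem balanced_discOcc (π : Plan M) {y0 : Fin n → ℝ}
    (hy0 : y0 ∈ M.Y) : Balanced M ε y0 (discOcc M ε π.π y0) := by
  intro V hV
  rw [lintegral_discOcc π hy0 (k := fun p => V p.1) (hV.comp measurable_fst),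
    lintegral_discOcc π hy0 (hV.lintegral_kernel (κ := transition M)),
    tsum_eq_zero_add' ENNReal.summable, mul_add, add_comm]
  congr 1
  · rw [mul_left_comm, ← ENNReal.tsum_mul_left (a := ENNReal.ofReal (1 - ε))]
    congr 2 with t
    rw [planKernel_succ, Kernel.lintegral_comp _ _ _ hV, pow_succ', mul_assoc]
    rfl
  · simp [planKernel, Kernel.id_apply, lintegral_dirac' _ hV]

theorem ThetaEps_subset_WepsPM (hε : ε ∈ Set.Ioo (0 : ℝ) 1) {y0 : Fin n → ℝ}
    (hy0 : y0 ∈ M.Y) : ThetaEps M ε y0 ⊆ WepsPM M ε y0 := by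
  rintro γ ⟨π, hπ⟩
  refine (mem_Weps_iff_balanced M hε).2 ⟨inferInstance, ?_⟩
  rw [hπ]
  exact ⟨onG_discOcc π hy0, balanced_discOcc π hy0⟩

theorem convexCombos_subset_WepsPM (hε : ε ∈ Set.Ioo (0 : ℝ) 1) {y0 : Fin n → ℝ}
    {A : Set (ProbabilityMeasure ((Fin n → ℝ) × Uc))} (hA : A ⊆ WepsPM M ε y0) :
    convexCombos A ⊆ WepsPM M ε y0 := by
  rintro μ ⟨m, w, γ, hγ, hw, hμ⟩
  have h i := (mem_Weps_iff_balanced M hε).1 (hA (hγ i))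
  refine (mem_Weps_iff_balanced M hε).2 ⟨inferInstance, ?_⟩
  rw [hμ]
  refine ⟨?_, fun V hV => ?_⟩
  · simp only [onG, Measure.coe_finsetSum, Finset.sum_apply, Measure.smul_apply]
    exact Finset.sum_eq_zero fun i _ => by rw [(h i).2.1, smul_zero]
  · have hw' : ∑ i, (w i : ℝ≥0∞) = 1 := by exact_mod_cast congrArg ((↑) : ℝ≥0 → ℝ≥0∞) hw
    simp only [lintegral_finsetSum_measure, lintegral_smul_measure, smul_eq_mul]
    rw [← one_mul (ENNReal.ofReal ε * V y0), ← hw', Finset.sum_mul, Finset.mul_sum,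
      ← Finset.sum_add_distrib]
    refine Finset.sum_congr rfl fun i _ => ?_
    rw [(h i).2.2 V hV, mul_add, mul_left_comm]

end Occupational

section DynamicProgramming

open ProbabilityTheory

variable (M : Model n Uc S) (ε : ℝ) (k : (Fin n → ℝ) × Uc → ℝ≥0∞)

open Classical in
/-- The right-hand side of the discounted dynamic programming equation with continuation
value `V`. -/
def stageCost (V : (Fin n → ℝ) → ℝ≥0∞) (p : (Fin n → ℝ) × Uc) : ℝ≥0∞ :=
  if p ∈ graphG M then
    ENNReal.ofReal ε * k p + ENNReal.ofReal (1 - ε) * ∫⁻ y, V y ∂transition M p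
  else ⊤

/-- Value iteration started from zero. -/
def valueIter : ℕ → (Fin n → ℝ) → ℝ≥0∞
  | 0 => fun _ => 0
  | j + 1 => fun y => ⨅ u, stageCost M ε k (valueIter j) (y, u)

variable {M ε k}

theorem stageCost_of_mem {V : (Fin n → ℝ) → ℝ≥0∞} {p : (Fin n → ℝ) × Uc}
    (hp : p ∈ graphG M) : stageCost M ε k V p =
      ENNReal.ofReal ε * k p + ENNReal.ofReal (1 - ε) * ∫⁻ y, V y ∂transition M p :=
  if_pos hp

theorem mem_graphG_of_stageCost_ne_top {V : (Fin n → ℝ) → ℝ≥0∞} {p : (Fin n → ℝ) × Uc}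
    (h : stageCost M ε k V p ≠ ⊤) : p ∈ graphG M :=
  by_contra fun hp => h (if_neg hp)

theorem stageCost_mono {V W : (Fin n → ℝ) → ℝ≥0∞} (h : V ≤ W) :
    stageCost M ε k V ≤ stageCost M ε k W := by
  intro p
  unfold stageCost
  split_ifs
  · gcongr
    exact h _
  · exact le_rfl

theorem stageCost_eq_lintegral {V : (Fin n → ℝ) → ℝ≥0∞} (hV : Measurable V)
    {p : (Fin n → ℝ) × Uc} (hp : p ∈ graphG M) : stageCost M ε k V p =
      ∫⁻ s, (ENNReal.ofReal ε * k p + ENNReal.ofReal (1 - ε) * V (M.f p.1 p.2 s)) ∂M.ν := by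
  have := M.ν_prob
  have hm : Measurable fun s => V (M.f p.1 p.2 s) := hV.comp (M.f_meas _ hp.1 _)
  rw [stageCost_of_mem hp, lintegral_transition M hp.1 hV,
    lintegral_add_left measurable_const, lintegral_const_mul _ hm]
  simp

theorem lowerSemicontinuous_stageCost (hk : Continuous k) {V : (Fin n → ℝ) → ℝ≥0∞}
    (hV : LowerSemicontinuous V) : LowerSemicontinuous (stageCost M ε k V) := by
  rw [lowerSemicontinuous_iff_isClosed_preimage]
  intro c
  rcases eq_or_ne c ⊤ with rfl | hc
  · simp
  refine IsSeqClosed.isClosed fun p q hp hq => ?_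
  have hpG i : p i ∈ graphG M :=
    mem_graphG_of_stageCost_ne_top (ne_top_of_le_ne_top hc (hp i))
  have hqG : q ∈ graphG M := (isClosed_graphG M).mem_of_tendsto hq (.of_forall hpG)
  let h (s : S) (p : (Fin n → ℝ) × Uc) : ℝ≥0∞ :=
    ENNReal.ofReal ε * k p + ENNReal.ofReal (1 - ε) * V (M.f p.1 p.2 s)
  have hlsc s : LowerSemicontinuousOn (h s) (graphG M) := by
    refine LowerSemicontinuousOn.add (ContinuousOn.lowerSemicontinuousOn ?_) ?_
    · exact ((ENNReal.continuous_const_mul ENNReal.ofReal_ne_top).comp hk).continuousOn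
    · have hdV : LowerSemicontinuous fun y => ENNReal.ofReal (1 - ε) * V y :=
        (ENNReal.continuous_const_mul ENNReal.ofReal_ne_top).comp_lowerSemicontinuous hV
          fun a b hab => mul_le_mul_right hab _
      exact (hdV.lowerSemicontinuousOn univ).comp
        ((M.f_cont s).mono fun p hp => ⟨hp.1, mem_univ _⟩) (mapsTo_univ _ _)
  have hlim : Tendsto p atTop (𝓝[graphG M] q) :=
    tendsto_nhdsWithin_iff.2 ⟨hq, .of_forall hpG⟩
  have hmeas i : Measurable fun s => h s (p i) := by
    have : Measurable fun s => M.f (p i).1 (p i).2 s := M.f_meas _ (hpG i).1 _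
    exact ((hV.measurable.comp this).const_mul _).const_add _
  calc stageCost M ε k V q = ∫⁻ s, h s q ∂M.ν := stageCost_eq_lintegral hV.measurable hqG
    _ ≤ ∫⁻ s, liminf (fun i => h s (p i)) atTop ∂M.ν := by
      refine lintegral_mono fun s => le_of_forall_lt fun b hb => ?_
      obtain ⟨b', hbb', hb'⟩ := exists_between hb
      exact hbb'.trans_le (le_liminf_of_le (by isBoundedDefault)
        ((hlim.eventually (hlsc s q hqG b' hb')).mono fun i hi => hi.le))
    _ ≤ liminf (fun i => ∫⁻ s, h s (p i) ∂M.ν) atTop := lintegral_liminf_le hmeas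
    _ ≤ c := by
      refine liminf_le_of_le (by isBoundedDefault) fun b hb => ?_
      obtain ⟨i, hi⟩ := hb.exists
      exact hi.trans ((stageCost_eq_lintegral hV.measurable (hpG i)).symm.trans_le (hp i))

theorem nonempty_control (M : Model n Uc S) : Nonempty Uc :=
  let ⟨_, hy⟩ := M.Y_nonempty
  (M.U_nonempty _ hy).to_type

theorem lowerSemicontinuous_valueIter (hk : Continuous k) (j : ℕ) :
    LowerSemicontinuous (valueIter M ε k j) := by
  have := nonempty_control M
  induction j with
  | zero => exact lowerSemicontinuous_const
  | succ j ih => exact lowerSemicontinuous_iInf_snd (lowerSemicontinuous_stageCost hk ih)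

theorem valueIter_le_succ (j : ℕ) : valueIter M ε k j ≤ valueIter M ε k (j + 1) := by
  induction j with
  | zero => exact fun y => bot_le
  | succ j ih => exact fun y => iInf_mono fun u => stageCost_mono ih _

theorem stageCost_le (hε : ε ∈ Set.Ioo (0 : ℝ) 1) {K : ℝ≥0∞} (hK : ∀ p, k p ≤ K)
    {V : (Fin n → ℝ) → ℝ≥0∞} (hV : ∀ y ∈ M.Y, V y ≤ K) {p : (Fin n → ℝ) × Uc}
    (hp : p ∈ graphG M) : stageCost M ε k V p ≤ K := by
  have h : ∫⁻ y, V y ∂transition M p ≤ K := by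
    calc ∫⁻ y, V y ∂transition M p ≤ ∫⁻ _, K ∂transition M p :=
          lintegral_mono_ae ((transition_ae_mem M hp).mono hV)
      _ = K := by simp
  rw [stageCost_of_mem hp, ← one_mul K, ← ofReal_add_ofReal_one_sub hε, add_mul]
  gcongr
  exact hK p

theorem valueIter_le (hε : ε ∈ Set.Ioo (0 : ℝ) 1) {K : ℝ≥0∞} (hK : ∀ p, k p ≤ K)
    (j : ℕ) {y : Fin n → ℝ} (hy : y ∈ M.Y) : valueIter M ε k j y ≤ K := by
  induction j generalizing y with
  | zero => exact bot_le
  | succ j ih =>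
    obtain ⟨u, hu⟩ := M.U_nonempty y hy
    exact (iInf_le _ u).trans (stageCost_le hε hK (fun z hz => ih hz) ⟨hy, hu⟩)

theorem valueIter_le_lintegral (hε : ε ∈ Set.Ioo (0 : ℝ) 1) (hk : Continuous k) {K : ℝ≥0∞}
    (hK : ∀ p, k p ≤ K) (hK' : K ≠ ⊤) {y0 : Fin n → ℝ} {γ : Measure ((Fin n → ℝ) × Uc)}
    [IsProbabilityMeasure γ] (hγ : onG M γ) (hb : Balanced M ε y0 γ) (j : ℕ) :
    valueIter M ε k j y0 ≤ ∫⁻ p, k p ∂γ := by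
  have hV := (lowerSemicontinuous_valueIter (M := M) (ε := ε) hk j).measurable
  have hA := hb _ hV
  have hle : ∫⁻ p, valueIter M ε k j p.1 ∂γ ≤ K := by
    calc ∫⁻ p, valueIter M ε k j p.1 ∂γ ≤ ∫⁻ _, K ∂γ :=
          lintegral_mono_ae (((onG_iff_ae M).1 hγ).mono fun p hp => valueIter_le hε hK j hp.1)
      _ = K := by simp
  have hfin : ENNReal.ofReal (1 - ε) *
      ∫⁻ p, ∫⁻ y, valueIter M ε k j y ∂transition M p ∂γ ≠ ⊤ :=
    ne_top_of_le_ne_top hK' ((le_self_add.trans hA.ge).trans hle)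
  have hstep : ∫⁻ p, valueIter M ε k j p.1 ∂γ ≤
      ENNReal.ofReal (1 - ε) * ∫⁻ p, ∫⁻ y, valueIter M ε k j y ∂transition M p ∂γ +
        ENNReal.ofReal ε * ∫⁻ p, k p ∂γ := by
    rw [← lintegral_const_mul _ hV.lintegral_kernel, ← lintegral_const_mul _ hk.measurable,
      ← lintegral_add_right _ (hk.measurable.const_mul _)]
    refine lintegral_mono_ae (((onG_iff_ae M).1 hγ).mono fun p hp => ?_)
    calc valueIter M ε k j p.1 ≤ stageCost M ε k (valueIter M ε k j) (p.1, p.2) :=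
          (valueIter_le_succ j p.1).trans (iInf_le _ p.2)
      _ = _ := by rw [stageCost_of_mem hp, add_comm]
  rw [hA, ENNReal.add_le_add_iff_left hfin] at hstep
  exact (ENNReal.mul_le_mul_iff_right (by simpa using hε.1) ENNReal.ofReal_ne_top).1 hstep

theorem exists_measurable_selector (hε : ε ∈ Set.Ioo (0 : ℝ) 1) (hk : Continuous k)
    {K : ℝ≥0∞} (hK : ∀ p, k p ≤ K) (hK' : K ≠ ⊤) {V : (Fin n → ℝ) → ℝ≥0∞}
    (hV : LowerSemicontinuous V) (hVK : ∀ y ∈ M.Y, V y ≤ K) :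
    ∃ g : (Fin n → ℝ) → Uc, Measurable g ∧ ∀ y ∈ M.Y, g y ∈ M.U y ∧
      stageCost M ε k V (y, g y) ≤ ⨅ u, stageCost M ε k V (y, u) := by
  have := nonempty_control M
  obtain ⟨g, hg, hle⟩ := exists_measurable_argmin
    (lowerSemicontinuous_stageCost (M := M) (ε := ε) hk hV)
  refine ⟨g, hg, fun y hy => ⟨?_, hle y⟩⟩
  obtain ⟨u, hu⟩ := M.U_nonempty y hy
  have h : stageCost M ε k V (y, g y) ≤ K :=
    ((hle y).trans (iInf_le _ u)).trans (stageCost_le hε hK hVK ⟨hy, hu⟩)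
  exact (mem_graphG_of_stageCost_ne_top (ne_top_of_le_ne_top hK' h)).2

/-- The plan using the decision rule `g` at time zero and following `π` afterwards. -/
def Plan.cons (g : (Fin n → ℝ) → Uc) (hg : Measurable g) (hU : ∀ y ∈ M.Y, g y ∈ M.U y)
    (π : Plan M) : Plan M where
  π
    | 0 => g
    | t + 1 => π.π t
  measurable
    | 0 => hg
    | t + 1 => π.measurable t
  feasible
    | 0 => hU
    | t + 1 => π.feasible t

variable (ε k) in
/-- The expected discounted cost of a plan, as a function of the initial state. -/
def planCost (π : Plan M) (y : Fin n → ℝ) : ℝ≥0∞ :=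
  ENNReal.ofReal ε *
    ∑' t : ℕ, ENNReal.ofReal (1 - ε) ^ t * ∫⁻ z, k (z, π.π t z) ∂planKernel t π y

theorem measurable_decisionCost (hk : Measurable k) (π : Plan M) (t : ℕ) :
    Measurable fun z => k (z, π.π t z) :=
  hk.comp (measurable_id.prodMk (π.measurable t))

theorem planCost_eq (hk : Measurable k) (π : Plan M) (y : Fin n → ℝ) :
    planCost ε k π y = ENNReal.ofReal ε * k (y, π.π 0 y) +
      ENNReal.ofReal (1 - ε) * ∫⁻ z, planCost ε k π.tail z ∂π.step 0 y := by
  have hm t : Measurable fun z => ∫⁻ w, k (w, π.tail.π t w) ∂planKernel t π.tail z :=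
    (measurable_decisionCost hk π.tail t).lintegral_kernel
  simp only [planCost]
  rw [lintegral_const_mul _ (Measurable.tsum fun t => (hm t).const_mul _),
    lintegral_tsum fun t => ((hm t).const_mul _).aemeasurable,
    tsum_eq_zero_add' ENNReal.summable, mul_add, mul_left_comm (ENNReal.ofReal (1 - ε)),
    ← ENNReal.tsum_mul_left (a := ENNReal.ofReal (1 - ε))]
  congr 2
  · simp [planKernel, Kernel.id_apply, lintegral_dirac' _ (measurable_decisionCost hk π 0)]
  · refine tsum_congr fun t => ?_
    rw [lintegral_const_mul _ (hm t), planKernel,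
      Kernel.lintegral_comp _ _ _ (measurable_decisionCost hk π (t + 1)), pow_succ', mul_assoc]
    rfl

theorem planCost_le (hε : ε ∈ Set.Ioo (0 : ℝ) 1) {K : ℝ≥0∞} (hK : ∀ p, k p ≤ K)
    (π : Plan M) (y : Fin n → ℝ) : planCost ε k π y ≤ K := by
  have h t : ∫⁻ z, k (z, π.π t z) ∂planKernel t π y ≤ K := by
    calc ∫⁻ z, k (z, π.π t z) ∂planKernel t π y ≤ ∫⁻ _, K ∂planKernel t π y :=
          lintegral_mono fun z => hK _
      _ = K := by simp
  calc planCost ε k π y ≤ ENNReal.ofReal ε * ∑' t : ℕ, ENNReal.ofReal (1 - ε) ^ t * K := by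
        unfold planCost
        gcongr
        exact h _
    _ = K := by rw [ENNReal.tsum_mul_right, ← mul_assoc, ofReal_mul_tsum_geometric hε, one_mul]

theorem exists_planCost_le (hε : ε ∈ Set.Ioo (0 : ℝ) 1) (hk : Continuous k)
    {K : ℝ≥0∞} (hK : ∀ p, k p ≤ K) (hK' : K ≠ ⊤) (N : ℕ) :
    ∃ π : Plan M, ∀ y ∈ M.Y,
      planCost ε k π y ≤ valueIter M ε k N y + ENNReal.ofReal (1 - ε) ^ N * K := by
  induction N with
  | zero =>
    obtain ⟨g, hg, hgU⟩ := exists_measurable_selector (M := M) hε hk hK hK'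
      (lowerSemicontinuous_valueIter hk 0) fun y hy => valueIter_le hε hK 0 hy
    refine ⟨⟨fun _ => g, fun _ => hg, fun _ y hy => (hgU y hy).1⟩, fun y _ => ?_⟩
    simpa [valueIter] using planCost_le hε hK _ y
  | succ N ih =>
    obtain ⟨π, hπ⟩ := ih
    obtain ⟨g, hg, hgU⟩ := exists_measurable_selector (M := M) hε hk hK hK'
      (lowerSemicontinuous_valueIter hk N) fun y hy => valueIter_le hε hK N hy
    refine ⟨Plan.cons g hg (fun y hy => (hgU y hy).1) π, fun y hy => ?_⟩
    have hmem : (y, g y) ∈ graphG M := ⟨hy, (hgU y hy).1⟩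
    calc planCost ε k (Plan.cons g hg (fun y hy => (hgU y hy).1) π) y
        = ENNReal.ofReal ε * k (y, g y) +
          ENNReal.ofReal (1 - ε) * ∫⁻ z, planCost ε k π z ∂transition M (y, g y) :=
          planCost_eq hk.measurable _ y
      _ ≤ ENNReal.ofReal ε * k (y, g y) + ENNReal.ofReal (1 - ε) *
          ∫⁻ z, (valueIter M ε k N z + ENNReal.ofReal (1 - ε) ^ N * K)
            ∂transition M (y, g y) := by
          refine add_le_add_right (mul_le_mul_right ?_ _) _
          exact lintegral_mono_ae ((transition_ae_mem M hmem).mono hπ)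
      _ = stageCost M ε k (valueIter M ε k N) (y, g y) + ENNReal.ofReal (1 - ε) ^ (N + 1) * K := by
          rw [lintegral_add_right _ measurable_const, stageCost_of_mem hmem, mul_add, pow_succ',
            mul_assoc, add_assoc]
          simp
      _ ≤ valueIter M ε k (N + 1) y + ENNReal.ofReal (1 - ε) ^ (N + 1) * K := by
          gcongr
          exact (hgU y hy).2

/-- Discounted occupational measures are optimal among discounted stationary measures, up to an
arbitrarily small error. -/
theorem exists_lintegral_discOcc_le (hε : ε ∈ Set.Ioo (0 : ℝ) 1) (hk : Continuous k)
    {K : ℝ≥0∞} (hK : ∀ p, k p ≤ K) (hK' : K ≠ ⊤) {y0 : Fin n → ℝ} (hy0 : y0 ∈ M.Y)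
    {γ : Measure ((Fin n → ℝ) × Uc)} (hγ : γ ∈ Weps M ε y0) {δ : ℝ≥0∞} (hδ : δ ≠ 0) :
    ∃ π : Plan M, ∫⁻ p, k p ∂discOcc M ε π.π y0 ≤ ∫⁻ p, k p ∂γ + δ := by
  obtain ⟨hprob, hG, hb⟩ := (mem_Weps_iff_balanced M hε).1 hγ
  have hlim : Tendsto (fun N => ENNReal.ofReal (1 - ε) ^ N * K) atTop (𝓝 0) := by
    rw [← zero_mul K]
    refine ENNReal.Tendsto.mul_const (ENNReal.tendsto_pow_atTop_nhds_zero_of_lt_one ?_) (.inr hK')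
    simpa using hε.1
  obtain ⟨N, hN⟩ := (hlim.eventually_le_const (pos_iff_ne_zero.2 hδ)).exists
  obtain ⟨π, hπ⟩ := exists_planCost_le (M := M) hε hk hK hK' N
  refine ⟨π, ?_⟩
  rw [lintegral_discOcc π hy0 hk.measurable]
  exact (hπ y0 hy0).trans (add_le_add (valueIter_le_lintegral hε hk hK hK' hG hb N) hN)

end DynamicProgramming

section Separation

open scoped BoundedContinuousFunction

variable {Ω : Type*} [MeasurableSpace Ω]

theorem convexHull_image_subset_image_convexCombos {E : Type*} [AddCommGroup E] [Module ℝ E]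
    {Φ : ProbabilityMeasure Ω → E}
    (hΦ : ∀ (m : ℕ) (w : Fin m → ℝ≥0) (γ : Fin m → ProbabilityMeasure Ω)
      (μ : ProbabilityMeasure Ω), μ.toMeasure = ∑ i, (w i : ℝ≥0∞) • (γ i).toMeasure →
        Φ μ = ∑ i, (w i : ℝ) • Φ (γ i)) (A : Set (ProbabilityMeasure Ω)) :
    convexHull ℝ (Φ '' A) ⊆ Φ '' convexCombos A := by
  intro x hx
  obtain ⟨ι, _, w, z, hw, hw1, hz, rfl⟩ := mem_convexHull_iff_exists_fintype.1 hx
  choose γ hγA hγ using hz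
  let e := (Fintype.equivFin ι).symm
  let v : Fin (Fintype.card ι) → ℝ≥0 := fun i => ⟨w (e i), hw _⟩
  have hv : ∑ i, v i = 1 := by
    rw [← NNReal.coe_inj, NNReal.coe_sum, NNReal.coe_one, ← hw1]
    exact e.sum_comp w
  let μ : Measure Ω := ∑ i, (v i : ℝ≥0∞) • (γ (e i)).toMeasure
  have hμ : IsProbabilityMeasure μ := by
    constructor
    simp only [μ, Measure.coe_finsetSum, Finset.sum_apply, Measure.smul_apply, measure_univ,
      smul_eq_mul, mul_one]
    exact_mod_cast congrArg ((↑) : ℝ≥0 → ℝ≥0∞) hv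
  refine ⟨⟨μ, hμ⟩, ⟨_, v, fun i => γ (e i), fun i => hγA _, hv, rfl⟩, ?_⟩
  rw [hΦ _ v (fun i => γ (e i)) ⟨μ, hμ⟩ rfl, ← e.sum_comp]
  exact Finset.sum_congr rfl fun i _ => by rw [hγ]; rfl

variable [TopologicalSpace Ω] [OpensMeasurableSpace Ω]

section Pairing

variable {E : Type*} [AddCommGroup E] [Module ℝ E] {B : E →ₗ[ℝ] (Ω →ᵇ ℝ) →ₗ[ℝ] ℝ}
  {Φ : ProbabilityMeasure Ω → WeakBilin B}

theorem mem_closure_of_mem_closure_image (hB : Function.Injective B)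
    (hΦ : ∀ μ q, B (Φ μ) q = ∫ x, q x ∂μ.toMeasure)
    {C : Set (ProbabilityMeasure Ω)} {μ : ProbabilityMeasure Ω}
    (h : Φ μ ∈ closure (Φ '' C)) : μ ∈ closure C := by
  rw [mem_closure_iff_clusterPt, ClusterPt, ← map_principal, inf_comm, ← Filter.push_pull] at h
  have : NeBot (𝓟 C ⊓ comap Φ (𝓝 (Φ μ))) := h.of_map
  refine mem_closure_of_tendsto (f := id) (b := 𝓟 C ⊓ comap Φ (𝓝 (Φ μ))) ?_
    (mem_inf_of_left (mem_principal_self C))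
  refine ProbabilityMeasure.tendsto_iff_forall_integral_tendsto.2 fun q => ?_
  simp only [← hΦ]
  exact (WeakBilin.tendsto_iff_forall_eval_tendsto B hB).1
    (tendsto_comap.mono_left inf_le_right) q

theorem eq_sum_smul_of_toMeasure_eq (hB : Function.Injective B)
    (hΦ : ∀ μ q, B (Φ μ) q = ∫ x, q x ∂μ.toMeasure)
    {m : ℕ} (w : Fin m → ℝ≥0) (γ : Fin m → ProbabilityMeasure Ω) (μ : ProbabilityMeasure Ω)
    (hμ : μ.toMeasure = ∑ i, (w i : ℝ≥0∞) • (γ i).toMeasure) :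
    Φ μ = ∑ i, (w i : ℝ) • Φ (γ i) := by
  refine hB (LinearMap.ext fun q => ?_)
  have hsum : B (∑ i, (w i : ℝ) • Φ (γ i)) q = ∑ i, (w i : ℝ) * B (Φ (γ i)) q := by
    refine (map_sum (WeakBilin.eval B q) _ _).trans (Finset.sum_congr rfl fun i _ => ?_)
    exact (WeakBilin.eval B q).map_smul _ _
  refine Eq.trans ?_ hsum.symm
  simp only [hΦ, hμ]
  rw [integral_finsetSum_measure fun i _ =>
    (q.integrable (γ i).toMeasure).smul_measure ENNReal.coe_ne_top]
  simp [NNReal.smul_def]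

theorem exists_integral_separating_of_pairing (hB : Function.Injective B)
    (hΦ : ∀ μ q, B (Φ μ) q = ∫ x, q x ∂μ.toMeasure)
    {A : Set (ProbabilityMeasure Ω)} {γ : ProbabilityMeasure Ω}
    (hγ : γ ∉ closure (convexCombos A)) :
    ∃ (q : Ω →ᵇ ℝ) (u : ℝ), ∫ x, q x ∂γ.toMeasure < u ∧
      ∀ μ ∈ A, u < ∫ x, q x ∂μ.toMeasure := by
  have h : Φ γ ∉ closure (convexHull ℝ (Φ '' A)) := fun h =>
    hγ (mem_closure_of_mem_closure_image hB hΦ (closure_mono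
      (convexHull_image_subset_image_convexCombos
        (fun _ => eq_sum_smul_of_toMeasure_eq hB hΦ) A) h))
  obtain ⟨f, u, hfγ, hf⟩ := geometric_hahn_banach_point_closed
    (convex_convexHull ℝ _).closure isClosed_closure h
  obtain ⟨q, rfl⟩ := LinearMap.dualEmbedding_surjective _ f
  refine ⟨q, u, hΦ γ q ▸ hfγ, fun μ hμ => hΦ μ q ▸ ?_⟩
  exact hf _ (subset_closure (subset_convexHull ℝ _ (mem_image_of_mem _ hμ)))

end Pairing

theorem exists_integral_separating {A : Set (ProbabilityMeasure Ω)} {γ : ProbabilityMeasure Ω}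
    (hγ : γ ∉ closure (convexCombos A)) :
    ∃ (q : Ω →ᵇ ℝ) (u : ℝ), ∫ x, q x ∂γ.toMeasure < u ∧
      ∀ μ ∈ A, u < ∫ x, q x ∂μ.toMeasure :=
  exists_integral_separating_of_pairing (E := Module.Dual ℝ (Ω →ᵇ ℝ)) (B := LinearMap.id)
    (Φ := fun μ => ({
      toFun := fun q => ∫ x, q x ∂μ.toMeasure
      map_add' := fun p q => integral_add (p.integrable _) (q.integrable _)
      map_smul' := fun c q => integral_const_mul c q } : Module.Dual ℝ (Ω →ᵇ ℝ)))
    Function.injective_id (fun _ _ => rfl) hγ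

end Separation

theorem exists_integral_discOcc_le {M : Model n Uc S} {ε : ℝ} (hε : ε ∈ Set.Ioo (0 : ℝ) 1)
    {y0 : Fin n → ℝ} (hy0 : y0 ∈ M.Y) {γ : Measure ((Fin n → ℝ) × Uc)}
    (hγ : γ ∈ Weps M ε y0) (q : BoundedContinuousFunction ((Fin n → ℝ) × Uc) ℝ) {u : ℝ}
    (hu : ∫ p, q p ∂γ < u) : ∃ π : Plan M, ∫ p, q p ∂discOcc M ε π.π y0 ≤ u := by
  have hq p : |q p| ≤ ‖q‖ := q.norm_coe_le_norm p
  have hint (μ : Measure ((Fin n → ℝ) × Uc)) [IsProbabilityMeasure μ] :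
      ∫⁻ p, ENNReal.ofReal (q p + ‖q‖) ∂μ = ENNReal.ofReal (∫ p, q p ∂μ + ‖q‖) := by
    rw [← ofReal_integral_eq_lintegral_ofReal (f := fun p => q p + ‖q‖)
        ((q.integrable μ).add (integrable_const _))
      (.of_forall fun p => by have := neg_le_of_abs_le (hq p); simp; linarith),
      integral_add (q.integrable μ) (integrable_const _)]
    simp
  have := hγ.1
  have hγq : -‖q‖ ≤ ∫ p, q p ∂γ := by
    have := integral_mono (μ := γ) (integrable_const (-‖q‖)) (q.integrable γ)
      fun p => neg_le_of_abs_le (hq p)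
    simpa using this
  obtain ⟨π, hπ⟩ := exists_lintegral_discOcc_le hε
    (k := fun p => ENNReal.ofReal (q p + ‖q‖)) (ENNReal.continuous_ofReal.comp (by fun_prop))
    (K := ENNReal.ofReal (2 * ‖q‖))
    (fun p => ENNReal.ofReal_le_ofReal (by linarith [le_of_abs_le (hq p)]))
    ENNReal.ofReal_ne_top hy0 hγ (δ := ENNReal.ofReal (u - ∫ p, q p ∂γ)) (by simpa using hu)
  have := isProbabilityMeasure_discOcc hε π hy0
  refine ⟨π, ?_⟩
  rw [hint, hint, ← ENNReal.ofReal_add (by linarith) (by linarith),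
    ENNReal.ofReal_le_ofReal_iff (by linarith)] at hπ
  linarith

/-- for every `ε ∈ (0,1)` and `y₀ ∈ Y`, the weak* closed convex hull of the
set of discounted occupational measures equals the set of discounted stationary measures. -/
theorem statement2 (M : Model n Uc S) (ε : ℝ) (hε : ε ∈ Set.Ioo (0 : ℝ) 1)
    (y0 : Fin n → ℝ) (hy0 : y0 ∈ M.Y) :
    closure (convexCombos (ThetaEps M ε y0)) = WepsPM M ε y0 := by
  refine Subset.antisymm (closure_minimal
    (convexCombos_subset_WepsPM hε (ThetaEps_subset_WepsPM hε hy0))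
    (isClosed_WepsPM M ε y0)) fun γ hγ => ?_
  by_contra hγ'
  obtain ⟨q, u, hqγ, hq⟩ := exists_integral_separating hγ'
  obtain ⟨π, hπ⟩ := exists_integral_discOcc_le hε hy0 hγ q hqγ
  exact (hq ⟨_, isProbabilityMeasure_discOcc hε π hy0⟩ ⟨π, rfl⟩).not_ge hπ

end StochLP
end
end

section
/- As ε → 0, the closed convex hull of the union over all initial conditions of the sets of discounted occupational measures converges in the Hausdorff metric to the set of stationary measures: lim_{ε→0} ρ_H(cl co Θ_ε, W) = 0, where Θ_ε := ∪_{y0∈Y} Θ_ε(y0). -/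
open MeasureTheory Filter Set Topology
open scoped ENNReal NNReal

noncomputable section

namespace StochLP

variable {n : ℕ} {Uc S : Type} [MetricSpace Uc] [CompactSpace Uc] [MeasurableSpace Uc]
  [BorelSpace Uc] [TopologicalSpace S] [PolishSpace S] [MeasurableSpace S] [BorelSpace S]

open ProbabilityTheory

/-- **Measurable selection** for closed-graph multifunctions with values in a compact metric
space. -/
theorem exists_measurable_selection {X K : Type*} [TopologicalSpace X] [MeasurableSpace X]
    [BorelSpace X] [MetricSpace K] [CompactSpace K] [MeasurableSpace K] [BorelSpace K]
    [Nonempty K] {G : Set (X × K)} (hG : IsClosed G) :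
    ∃ σ : X → K, Measurable σ ∧ ∀ y, (∃ u, (y, u) ∈ G) → (y, σ y) ∈ G := by
  obtain ⟨g₀, hg₀, hg₀s⟩ := exists_nat_bool_continuous_surjective_of_compact K
  have : CompactSpace cantorSet := isCompact_iff_compactSpace.1 isCompact_cantorSet
  let g : cantorSet → K := g₀ ∘ cantorSetHomeomorphNatToBool
  have hg : Continuous g := hg₀.comp cantorSetHomeomorphNatToBool.continuous
  have hgs : Function.Surjective g := hg₀s.comp cantorSetHomeomorphNatToBool.surjective
  let D : X → Set cantorSet := fun y => {c | (y, g c) ∈ G}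
  have hD (y) : IsCompact (D y) :=
    (hG.preimage ((Continuous.prodMk_right y).comp hg)).isCompact
  let c₀ : cantorSet := ⟨0, zero_mem_cantorSet⟩
  have hleast (y) : ∃ m : cantorSet, (D y).Nonempty ∧ IsLeast (D y) m ∨ D y = ∅ ∧ m = c₀ := by
    rcases (D y).eq_empty_or_nonempty with h | h
    · exact ⟨c₀, Or.inr ⟨h, rfl⟩⟩
    · obtain ⟨m, hm⟩ := (hD y).exists_isLeast h
      exact ⟨m, Or.inl ⟨h, hm⟩⟩
  choose m hm using hleast
  have hclosed (s : Set cantorSet) (hs : IsClosed s) :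
      IsClosed {y | ∃ c ∈ s, c ∈ D y} := by
    have : {y | ∃ c ∈ s, c ∈ D y} =
        Prod.fst '' {p : X × cantorSet | p.2 ∈ s ∧ (p.1, g p.2) ∈ G} := by
      ext y; simp [D]
    rw [this]
    refine isClosedMap_fst_of_compactSpace _ ?_
    exact (hs.preimage continuous_snd).inter
      (hG.preimage (continuous_fst.prodMk (hg.comp continuous_snd)))
  have hmeas : Measurable fun y => (m y : ℝ) := by
    refine measurable_of_Iic fun a => ?_
    have : (fun y => (m y : ℝ)) ⁻¹' Iic a =
        {y | ∃ c ∈ {c : cantorSet | (c : ℝ) ≤ a}, c ∈ D y} ∪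
          ({y | ∃ c ∈ univ, c ∈ D y}ᶜ ∩ {_y | (c₀ : ℝ) ≤ a}) := by
      ext y
      simp only [mem_preimage, mem_Iic, mem_union, mem_ofPred_eq, mem_inter_iff, mem_compl_iff,
        mem_univ, true_and]
      rcases hm y with ⟨hne, hl⟩ | ⟨he, h0⟩
      · constructor
        · exact fun h => Or.inl ⟨m y, h, hl.1⟩
        · rintro (⟨c, hc, hcD⟩ | ⟨h, -⟩)
          · exact (Subtype.coe_le_coe.2 (hl.2 hcD)).trans hc
          · exact absurd hne h
      · simp [he, h0]
    rw [this]
    refine (hclosed _ (isClosed_le continuous_subtype_val continuous_const)).measurableSet.union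
      ((hclosed _ isClosed_univ).measurableSet.compl.inter (.const _))
  refine ⟨g ∘ m, hg.measurable.comp (hmeas.subtype_mk (h := fun y => (m y).2)), fun y hy => ?_⟩
  rcases hm y with ⟨-, hl⟩ | ⟨he, -⟩
  · exact hl.1
  · obtain ⟨u, hu⟩ := hy
    obtain ⟨c, rfl⟩ := hgs u
    exact absurd (show c ∈ D y from hu) (by simp [he])

namespace Model

theorem isClosed_graphG (M : Model n Uc S) : IsClosed (graphG M) := M.graph_closed

theorem isCompact_graphG (M : Model n Uc S) : IsCompact (graphG M) :=
  (M.Y_compact.prod isCompact_univ).of_isClosed_subset M.isClosed_graphG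
    fun _ hp => ⟨hp.1, mem_univ _⟩

theorem measurableSet_graphG (M : Model n Uc S) : MeasurableSet (graphG M) :=
  M.isClosed_graphG.measurableSet

theorem measurableSet_Y (M : Model n Uc S) : MeasurableSet M.Y :=
  M.Y_compact.isClosed.measurableSet

theorem nonempty_control (M : Model n Uc S) : Nonempty Uc :=
  let ⟨y, hy⟩ := M.Y_nonempty
  (M.U_nonempty y hy).to_type

theorem exists_selection (M : Model n Uc S) :
    ∃ σ : (Fin n → ℝ) → Uc, Measurable σ ∧ ∀ y ∈ M.Y, σ y ∈ M.U y := by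
  have := M.nonempty_control
  obtain ⟨σ, hσ, h⟩ := exists_measurable_selection M.isClosed_graphG
  exact ⟨σ, hσ, fun y hy => (h y ((M.U_nonempty y hy).imp fun u hu => ⟨hy, hu⟩)).2⟩

open Classical in
/-- The one-step dynamics, frozen off the graph `G` so as to be jointly measurable. -/
def next (M : Model n Uc S) (p : (Fin n → ℝ) × Uc) (s : S) : Fin n → ℝ :=
  if p ∈ graphG M then M.f p.1 p.2 s else p.1

theorem next_of_mem (M : Model n Uc S) {p : (Fin n → ℝ) × Uc} (hp : p ∈ graphG M) (s : S) :
    M.next p s = M.f p.1 p.2 s := if_pos hp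

theorem next_mem (M : Model n Uc S) {p : (Fin n → ℝ) × Uc} (hp : p.1 ∈ M.Y) (s : S) :
    M.next p s ∈ M.Y := by
  unfold next
  split_ifs with h
  · exact M.f_inv _ h.1 _ h.2 s
  · exact hp

theorem continuous_next (M : Model n Uc S) (s : S) :
    Continuous fun p : graphG M => M.next p s := by
  have h : ContinuousOn (fun p : (Fin n → ℝ) × Uc => M.f p.1 p.2 s) (graphG M) :=
    (M.f_cont s).mono fun p hp => ⟨hp.1, mem_univ _⟩
  refine h.domRestrict.congr fun p => ?_
  exact (M.next_of_mem p.2 s).symm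

theorem measurable_next (M : Model n Uc S) : Measurable (Function.uncurry M.next) := by
  refine measurable_of_restrict_of_restrict_compl
    (M.measurableSet_graphG.preimage (measurable_fst (β := S))) ?_ ?_
  · have h := measurable_uncurry_of_continuous_of_measurable
      (u := fun (p : graphG M) (s : S) => M.next p s) M.continuous_next
      (fun p => by
        simpa only [M.next_of_mem p.2] using M.f_meas _ p.2.1 p.1.2)
    exact h.comp (((measurable_fst.comp measurable_subtype_coe).subtype_mk
      (h := fun p : (Prod.fst ⁻¹' graphG M : Set (((Fin n → ℝ) × Uc) × S)) => p.2)).prodMk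
      (measurable_snd.comp measurable_subtype_coe))
  · have : (Prod.fst ⁻¹' graphG M : Set (((Fin n → ℝ) × Uc) × S))ᶜ.domRestrict
        (Function.uncurry M.next) = fun p => p.1.1.1 := by
      ext1 p
      exact if_neg p.2
    rw [this]
    fun_prop

theorem measurable_next_right (M : Model n Uc S) (p : (Fin n → ℝ) × Uc) :
    Measurable (M.next p) :=
  M.measurable_next.comp measurable_prodMk_left

instance (M : Model n Uc S) : IsProbabilityMeasure M.ν := M.ν_prob

/-- The controlled transition kernel. -/
def step (M : Model n Uc S) : Kernel ((Fin n → ℝ) × Uc) (Fin n → ℝ) :=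
  (Kernel.id ×ₖ Kernel.const _ M.ν).map (Function.uncurry M.next)

instance (M : Model n Uc S) : IsMarkovKernel M.step :=
  Kernel.IsMarkovKernel.map _ M.measurable_next

theorem step_apply (M : Model n Uc S) (p : (Fin n → ℝ) × Uc) :
    M.step p = M.ν.map (M.next p) := by
  rw [step, Kernel.map_apply _ M.measurable_next, Kernel.prod_apply, Kernel.id_apply,
    Kernel.const_apply, Measure.dirac_prod, Measure.map_map M.measurable_next (by fun_prop)]
  rfl

theorem step_compl (M : Model n Uc S) {p : (Fin n → ℝ) × Uc} (hp : p.1 ∈ M.Y) :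
    M.step p M.Yᶜ = 0 := by
  rw [step_apply, Measure.map_apply (M.measurable_next_right p)
    M.measurableSet_Y.compl]
  convert measure_empty (μ := M.ν)
  ext s
  simp [M.next_mem hp s]

theorem integral_step (M : Model n Uc S) (p : (Fin n → ℝ) × Uc) {φ : (Fin n → ℝ) → ℝ}
    (hφ : Measurable φ) : ∫ z, φ z ∂M.step p = ∫ s, φ (M.next p s) ∂M.ν := by
  rw [step_apply, integral_map (M.measurable_next_right p).aemeasurable
    hφ.aestronglyMeasurable]

theorem Ef_eq (M : Model n Uc S) {p : (Fin n → ℝ) × Uc} (hp : p ∈ graphG M)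
    {φ ψ : (Fin n → ℝ) → ℝ} (hψ : Measurable ψ) (h : ∀ y ∈ M.Y, φ y = ψ y) :
    Ef M φ p.1 p.2 = ∫ z, ψ z ∂M.step p := by
  rw [M.integral_step p hψ, Ef]
  refine integral_congr_ae (.of_forall fun s => ?_)
  simp only [M.next_of_mem hp]
  exact h _ (M.f_inv _ hp.1 _ hp.2 s)

theorem exists_bounded_eqOn (M : Model n Uc S) {φ : (Fin n → ℝ) → ℝ} (hφ : Continuous φ) :
    ∃ ψ : BoundedContinuousFunction (Fin n → ℝ) ℝ, ∀ y ∈ M.Y, φ y = ψ y := by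
  obtain ⟨C, hC⟩ := M.Y_compact.exists_bound_of_continuousOn hφ.continuousOn
  refine ⟨.ofNormedAddCommGroup (fun y => max (-C) (min C (φ y))) (by fun_prop) |C|
    fun y => ?_, fun y hy => ?_⟩
  · rw [Real.norm_eq_abs, abs_le]
    constructor
    · exact (neg_le_neg (le_abs_self C)).trans (le_max_left _ _)
    · exact max_le (neg_le_abs C) ((min_le_left _ _).trans (le_abs_self C))
  · have := abs_le.1 (hC y hy)
    simp [this.1, this.2]

theorem exists_generator_extension (M : Model n Uc S)
    (ψ : BoundedContinuousFunction (Fin n → ℝ) ℝ) :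
    ∃ Q : BoundedContinuousFunction ((Fin n → ℝ) × Uc) ℝ, ∀ p ∈ graphG M,
      Q p = ∫ z, ψ z ∂M.step p - ψ p.1 := by
  have hc : Continuous fun p : graphG M => ∫ z, ψ z ∂M.step p - ψ p.1.1 := by
    refine .sub ?_ (by fun_prop)
    simp_rw [M.integral_step _ ψ.continuous.measurable]
    refine continuous_of_dominated (bound := fun _ => ‖ψ‖) (fun p => ?_)
      (fun p => .of_forall fun s => ψ.norm_coe_le_norm _) (integrable_const _)
      (.of_forall fun s => ψ.continuous.comp (M.continuous_next s))
    exact (ψ.continuous.measurable.comp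
      (M.measurable_next_right p)).aestronglyMeasurable
  have : CompactSpace (graphG M) := isCompact_iff_compactSpace.1 M.isCompact_graphG
  obtain ⟨Q, -, hQ⟩ := BoundedContinuousFunction.exists_norm_eq_domRestrict_eq_of_closed
    (BoundedContinuousFunction.mkOfCompact ⟨_, hc⟩) M.isClosed_graphG
  refine ⟨Q, fun p hp => ?_⟩
  exact congrArg (fun g => g ⟨p, hp⟩) hQ

end Model

namespace Plan

variable {M : Model n Uc S}

/-- The plan followed after the first time step. -/
def shift (π : Plan M) : Plan M where
  π t := π.π (t + 1)
  measurable t := π.measurable (t + 1)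
  feasible t := π.feasible (t + 1)

/-- The plan which uses `g` at time `0` and follows `π` afterwards. -/
def cons_s3 (π : Plan M) {g : (Fin n → ℝ) → Uc} (hg : Measurable g)
    (hgU : ∀ y ∈ M.Y, g y ∈ M.U y) : Plan M where
  π t := Nat.casesOn t g π.π
  measurable t := by cases t; exacts [hg, π.measurable _]
  feasible t := by cases t; exacts [hgU, π.feasible _]

instance : Nonempty (Plan M) :=
  let ⟨σ, hσ, h⟩ := M.exists_selection
  ⟨⟨fun _ => σ, fun _ => hσ, fun _ => h⟩⟩

/-- The state paired with the control applied at time `t`. -/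
def act (π : Plan M) (t : ℕ) (y : Fin n → ℝ) : (Fin n → ℝ) × Uc := (y, π.π t y)

theorem measurable_act (π : Plan M) (t : ℕ) : Measurable (π.act t) :=
  measurable_id.prodMk (π.measurable t)

theorem act_mem (π : Plan M) (t : ℕ) {y : Fin n → ℝ} (hy : y ∈ M.Y) : π.act t y ∈ graphG M :=
  ⟨hy, π.feasible t y hy⟩

/-- The law of the state at time `t` under a plan, as a kernel from the initial state. -/
def law : ℕ → Plan M → Kernel (Fin n → ℝ) (Fin n → ℝ)
  | 0, _ => Kernel.id
  | t + 1, π => law t π.shift ∘ₖ M.step.comap (π.act 0) (π.measurable_act 0)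

instance isMarkovKernel_law (t : ℕ) (π : Plan M) : IsMarkovKernel (law t π) := by
  induction t generalizing π with
  | zero => exact inferInstanceAs (IsMarkovKernel Kernel.id)
  | succ t ih => have := ih π.shift; unfold law; infer_instance

theorem law_succ' (t : ℕ) (π : Plan M) :
    law (t + 1) π = M.step.comap (π.act t) (π.measurable_act t) ∘ₖ law t π := by
  induction t generalizing π with
  | zero => simp [law]
  | succ t ih =>
    rw [law, ih, Kernel.comp_assoc]
    rfl

theorem ae_step_mem {p : (Fin n → ℝ) × Uc} (hp : p.1 ∈ M.Y) : ∀ᵐ z ∂M.step p, z ∈ M.Y :=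
  M.step_compl hp

theorem law_compl (t : ℕ) (π : Plan M) {y : Fin n → ℝ} (hy : y ∈ M.Y) :
    law t π y M.Yᶜ = 0 := by
  induction t generalizing π y with
  | zero => simp [law, Kernel.id_apply, Measure.dirac_apply' _ M.measurableSet_Y.compl, hy]
  | succ t ih =>
    rw [law, Kernel.comp_apply' _ _ _ M.measurableSet_Y.compl]
    exact lintegral_eq_zero_of_ae_eq_zero
      ((ae_step_mem (p := π.act 0 y) hy).mono fun z hz => ih _ hz)

theorem stateLaw_eq (t : ℕ) (π : Plan M) {y : Fin n → ℝ} (hy : y ∈ M.Y) :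
    stateLaw M t π.π y = law t π y := by
  induction t generalizing π y with
  | zero => rw [law, Kernel.id_apply]; rfl
  | succ t ih =>
    rw [law, Kernel.comp_apply, Kernel.comap_apply, M.step_apply]
    have h : M.next (π.act 0 y) = fun s => M.f y (π.π 0 y) s :=
      funext fun s => M.next_of_mem (π.act_mem 0 hy) s
    change (M.ν.map fun s => M.f y (π.π 0 y) s).bind (fun z => stateLaw M t π.shift.π z) = _
    rw [h]
    refine Measure.bind_congr_right ?_
    have := ae_step_mem (M := M) (p := π.act 0 y) hy
    rw [M.step_apply, h] at this
    exact this.mono fun z hz => ih _ hz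

theorem saLaw_eq (t : ℕ) (π : Plan M) {y : Fin n → ℝ} (hy : y ∈ M.Y) :
    saLaw M t π.π y = (law t π y).map (π.act t) := by
  rw [saLaw, stateLaw_eq t π hy]; rfl

theorem isProbabilityMeasure_saLaw (t : ℕ) (π : Plan M) {y : Fin n → ℝ} (hy : y ∈ M.Y) :
    IsProbabilityMeasure (saLaw M t π.π y) := by
  rw [saLaw_eq t π hy]
  exact Measure.isProbabilityMeasure_map (π.measurable_act t).aemeasurable

theorem saLaw_compl (t : ℕ) (π : Plan M) {y : Fin n → ℝ} (hy : y ∈ M.Y) :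
    saLaw M t π.π y (graphG M)ᶜ = 0 := by
  rw [saLaw_eq t π hy, Measure.map_apply (π.measurable_act t) M.measurableSet_graphG.compl]
  exact measure_mono_null (fun z hz hzY => hz (π.act_mem t hzY)) (law_compl t π hy)

theorem isProbabilityMeasure_discOcc {ε : ℝ} (hε : ε ∈ Ioo (0 : ℝ) 1) (π : Plan M)
    {y : Fin n → ℝ} (hy : y ∈ M.Y) : IsProbabilityMeasure (discOcc M ε π.π y) := by
  have (t : ℕ) := isProbabilityMeasure_saLaw t π hy
  constructor
  have h : 1 - ENNReal.ofReal (1 - ε) = ENNReal.ofReal ε := by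
    rw [← ENNReal.ofReal_one, ← ENNReal.ofReal_sub _ (by linarith [hε.2])]
    simp
  simp only [discOcc, Measure.smul_apply, Measure.sum_apply _ MeasurableSet.univ, measure_univ,
    smul_eq_mul, mul_one, ENNReal.tsum_geometric, h]
  exact ENNReal.mul_inv_cancel (by simpa using hε.1) ENNReal.ofReal_ne_top

theorem discOcc_compl (ε : ℝ) (π : Plan M) {y : Fin n → ℝ} (hy : y ∈ M.Y) :
    discOcc M ε π.π y (graphG M)ᶜ = 0 := by
  simp [discOcc, Measure.sum_apply _ M.measurableSet_graphG.compl, saLaw_compl _ π hy]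

/-- The expectation of `q` along the state-control trajectory at time `t`. -/
def expect (q : (Fin n → ℝ) × Uc → ℝ) (t : ℕ) (π : Plan M) (y : Fin n → ℝ) : ℝ :=
  ∫ z, q (π.act t z) ∂law t π y

theorem hasSum_discOcc {ε : ℝ} (hε : ε ∈ Ioo (0 : ℝ) 1) (π : Plan M) {y : Fin n → ℝ}
    (hy : y ∈ M.Y) (q : BoundedContinuousFunction ((Fin n → ℝ) × Uc) ℝ) :
    HasSum (fun t => ε * ((1 - ε) ^ t * expect q t π y)) (∫ p, q p ∂discOcc M ε π.π y) := by
  have := isProbabilityMeasure_discOcc hε π hy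
  have hsum : Integrable q (Measure.sum fun t : ℕ =>
      ENNReal.ofReal (1 - ε) ^ t • saLaw M t π.π y) := by
    have : Integrable q (discOcc M ε π.π y) := q.integrable _
    rwa [discOcc, integrable_smul_measure (by simpa using hε.1) ENNReal.ofReal_ne_top] at this
  rw [discOcc, integral_smul_measure, ENNReal.toReal_ofReal hε.1.le]
  refine ((hasSum_integral_measure hsum).mul_left ε).congr_fun ?_
  intro t
  rw [integral_smul_measure, saLaw_eq t π hy, integral_map (π.measurable_act t).aemeasurable
    q.continuous.aestronglyMeasurable, expect, ENNReal.toReal_pow,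
    ENNReal.toReal_ofReal (by linarith [hε.2])]
  rfl

theorem abs_expect_le {q : (Fin n → ℝ) × Uc → ℝ} {C : ℝ} (hC : ∀ p, |q p| ≤ C) (t : ℕ)
    (π : Plan M) (y : Fin n → ℝ) : |expect q t π y| ≤ C := by
  have := norm_integral_le_of_norm_le_const (μ := law t π y) (f := fun z => q (π.act t z))
    (.of_forall fun z => hC _)
  simpa [expect] using this

theorem measurable_expect {q : (Fin n → ℝ) × Uc → ℝ} (hq : Measurable q) (t : ℕ)
    (π : Plan M) : Measurable (expect q t π) :=
  (StronglyMeasurable.integral_kernel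
    (hq.comp (π.measurable_act t)).stronglyMeasurable).measurable

theorem expect_zero {q : (Fin n → ℝ) × Uc → ℝ} (hq : Measurable q) (π : Plan M)
    (y : Fin n → ℝ) : expect q 0 π y = q (π.act 0 y) := by
  rw [expect, law, Kernel.id_apply]
  exact integral_dirac' _ _ (hq.comp (π.measurable_act 0)).stronglyMeasurable

theorem expect_succ {q : (Fin n → ℝ) × Uc → ℝ} (hq : Measurable q) {C : ℝ}
    (hC : ∀ p, |q p| ≤ C) (t : ℕ) (π : Plan M) (y : Fin n → ℝ) :
    expect q (t + 1) π y = ∫ z, expect q t π.shift z ∂M.step (π.act 0 y) := by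
  rw [expect, law, Kernel.integral_comp]
  · rfl
  · exact .of_bound (hq.comp (π.measurable_act _)).aestronglyMeasurable C (.of_forall fun z => hC _)

theorem integral_law_succ {φ : (Fin n → ℝ) → ℝ} (hφ : Measurable φ) {C : ℝ}
    (hC : ∀ y, |φ y| ≤ C) (t : ℕ) (π : Plan M) (y : Fin n → ℝ) :
    ∫ z, φ z ∂law (t + 1) π y = ∫ z, ∫ z', φ z' ∂M.step (π.act t z) ∂law t π y := by
  rw [law_succ', Kernel.integral_comp]
  · rfl
  · exact .of_bound hφ.aestronglyMeasurable C (.of_forall fun z => hC _)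

end Plan

namespace Plan

variable {M : Model n Uc S}

theorem expect_generator (ψ : BoundedContinuousFunction (Fin n → ℝ) ℝ)
    {Q : (Fin n → ℝ) × Uc → ℝ} (hQ : ∀ p ∈ graphG M, Q p = ∫ z, ψ z ∂M.step p - ψ p.1)
    (t : ℕ) (π : Plan M) {y : Fin n → ℝ} (hy : y ∈ M.Y) :
    expect Q t π y = ∫ z, ψ z ∂law (t + 1) π y - ∫ z, ψ z ∂law t π y := by
  have hψ : Measurable ψ := ψ.continuous.measurable
  have hint : Integrable (fun z => ∫ z', ψ z' ∂M.step (π.act t z)) (law t π y) := by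
    refine .of_bound (C := ‖ψ‖) ?_ (.of_forall fun z => ?_)
    · exact ((StronglyMeasurable.integral_kernel hψ.stronglyMeasurable).measurable.comp
        (π.measurable_act t)).aestronglyMeasurable
    · simpa using norm_integral_le_of_norm_le_const (μ := M.step (π.act t z))
        (.of_forall ψ.norm_coe_le_norm)
  rw [integral_law_succ hψ ψ.norm_coe_le_norm, ← integral_sub hint (ψ.integrable _), expect]
  refine integral_congr_ae ?_
  have h : ∀ᵐ z ∂law t π y, z ∈ M.Y := law_compl t π hy
  exact h.mono fun z hz => hQ _ (π.act_mem t hz)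

theorem abs_integral_generator_discOcc_le {ε : ℝ} (hε : ε ∈ Ioo (0 : ℝ) 1) (π : Plan M)
    {y : Fin n → ℝ} (hy : y ∈ M.Y) (ψ : BoundedContinuousFunction (Fin n → ℝ) ℝ)
    {Q : BoundedContinuousFunction ((Fin n → ℝ) × Uc) ℝ}
    (hQ : ∀ p ∈ graphG M, Q p = ∫ z, ψ z ∂M.step p - ψ p.1) :
    |∫ p, Q p ∂discOcc M ε π.π y| ≤ 2 * ε * ‖ψ‖ := by
  set a : ℕ → ℝ := fun t => ∫ z, ψ z ∂law t π y with ha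
  have hε₀ : 0 ≤ 1 - ε := by linarith [hε.2]
  have hε₁ : 1 - ε < 1 := by linarith [hε.1]
  have hab (t) : |a t| ≤ ‖ψ‖ := by
    simpa using norm_integral_le_of_norm_le_const (μ := law t π y)
      (.of_forall ψ.norm_coe_le_norm)
  have hgeom := (hasSum_geometric_of_lt_one hε₀ hε₁).mul_right ‖ψ‖
  have hbd (s t : ℕ) : ‖(1 - ε) ^ t * a s‖ ≤ (1 - ε) ^ t * ‖ψ‖ := by
    rw [norm_mul, norm_pow, Real.norm_of_nonneg hε₀]
    gcongr
    exact hab s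
  have hA : Summable fun t => (1 - ε) ^ t * a t :=
    .of_norm_bounded hgeom.summable fun t => hbd t t
  have hA' : Summable fun t => (1 - ε) ^ t * a (t + 1) :=
    .of_norm_bounded hgeom.summable fun t => hbd (t + 1) t
  have hAle : |∑' t, (1 - ε) ^ t * a (t + 1)| ≤ ε⁻¹ * ‖ψ‖ := by
    simpa using tsum_of_norm_bounded hgeom fun t => hbd (t + 1) t
  have hsplit : ∑' t, (1 - ε) ^ t * a t = a 0 + (1 - ε) * ∑' t, (1 - ε) ^ t * a (t + 1) := by
    rw [hA.tsum_eq_zero_add, ← tsum_mul_left]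
    simp only [pow_zero, one_mul, pow_succ']
    simp only [mul_assoc]
  have hQsum := hasSum_discOcc hε π hy Q
  simp only [expect_generator ψ hQ _ π hy, mul_sub] at hQsum
  have hval := hQsum.unique ((hA'.hasSum.mul_left ε).sub (hA.hasSum.mul_left ε))
  rw [hval, hsplit]
  have hεA : |ε * ∑' t, (1 - ε) ^ t * a (t + 1)| ≤ ‖ψ‖ := by
    rw [abs_mul, abs_of_pos hε.1]
    calc _ ≤ ε * (ε⁻¹ * ‖ψ‖) := by gcongr; exact hε.1.le
      _ = ‖ψ‖ := by rw [mul_inv_cancel_left₀ hε.1.ne']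
  have : ∀ A, ε * A - ε * (a 0 + (1 - ε) * A) = ε * (ε * A - a 0) := fun A => by ring
  rw [this, abs_mul, abs_of_pos hε.1]
  calc _ ≤ ε * (‖ψ‖ + ‖ψ‖) := by
        gcongr
        · exact hε.1.le
        · exact (abs_sub _ _).trans (add_le_add hεA (hab 0))
    _ = 2 * ε * ‖ψ‖ := by ring

end Plan

theorem mem_WsetPM_of_integral_generator (M : Model n Uc S)
    {γ : ProbabilityMeasure ((Fin n → ℝ) × Uc)} (hγ : γ.toMeasure (graphG M)ᶜ = 0)
    (h : ∀ ψ : BoundedContinuousFunction (Fin n → ℝ) ℝ,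
      ∫ p, (∫ z, ψ z ∂M.step p - ψ p.1) ∂γ.toMeasure = 0) : γ ∈ WsetPM M := by
  refine ⟨inferInstance, hγ, fun φ hφ => ?_⟩
  obtain ⟨ψ, hψ⟩ := M.exists_bounded_eqOn hφ
  rw [← h ψ]
  refine integral_congr_ae ?_
  have hG : ∀ᵐ p ∂γ.toMeasure, p ∈ graphG M := hγ
  filter_upwards [hG] with p hp
  rw [M.Ef_eq hp ψ.continuous.measurable hψ, hψ _ hp.1]

theorem integral_generator_of_mem_Wset (M : Model n Uc S)
    {γ : Measure ((Fin n → ℝ) × Uc)} (hγ : γ ∈ Wset M)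
    (ψ : BoundedContinuousFunction (Fin n → ℝ) ℝ) :
    ∫ p, (∫ z, ψ z ∂M.step p - ψ p.1) ∂γ = 0 := by
  rw [← hγ.2.2 ψ ψ.continuous]
  refine integral_congr_ae ?_
  have hG : ∀ᵐ p ∂γ, p ∈ graphG M := hγ.2.1
  filter_upwards [hG] with p hp
  rw [M.Ef_eq hp ψ.continuous.measurable fun _ _ => rfl]

section ConvexCombos

variable {α : Type*} [MeasurableSpace α] [TopologicalSpace α] [OpensMeasurableSpace α]

theorem integral_sum_smul {m : ℕ} (w : Fin m → ℝ≥0) (γ : Fin m → ProbabilityMeasure α)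
    (q : BoundedContinuousFunction α ℝ) :
    ∫ x, q x ∂(∑ i, (w i : ℝ≥0∞) • (γ i).toMeasure) =
      ∑ i, (w i : ℝ) * ∫ x, q x ∂(γ i).toMeasure := by
  rw [integral_finsetSum_measure fun i _ =>
    (q.integrable (γ i).toMeasure).smul_measure ENNReal.coe_ne_top]
  simp [NNReal.smul_def]

theorem abs_integral_le_of_mem_closure_convexCombos {A : Set (ProbabilityMeasure α)}
    {q : BoundedContinuousFunction α ℝ} {C : ℝ}
    (h : ∀ γ ∈ A, |∫ x, q x ∂γ.toMeasure| ≤ C) :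
    ∀ γ ∈ closure (convexCombos A), |∫ x, q x ∂γ.toMeasure| ≤ C := by
  have hclosed : IsClosed {γ : ProbabilityMeasure α | |∫ x, q x ∂γ.toMeasure| ≤ C} :=
    isClosed_le (ProbabilityMeasure.continuous_integral_boundedContinuousFunction q).abs
      continuous_const
  refine fun μ hμ => closure_minimal (fun μ hμ => ?_) hclosed hμ
  obtain ⟨m, w, γ, hγ, hw, hμ⟩ := hμ
  have hw' : ∑ i, (w i : ℝ) = 1 := by exact_mod_cast hw
  rw [mem_ofPred_eq, hμ, integral_sum_smul]
  calc _ ≤ ∑ i, |(w i : ℝ) * ∫ x, q x ∂(γ i).toMeasure| := Finset.abs_sum_le_sum_abs _ _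
    _ ≤ ∑ i, (w i : ℝ) * C := by
        gcongr with i
        rw [abs_mul, NNReal.abs_eq]
        gcongr
        exact h _ (hγ i)
    _ = C := by rw [← Finset.sum_mul, hw', one_mul]

end ConvexCombos

theorem isCompact_concentrated {α : Type*} [MeasurableSpace α] [TopologicalSpace α]
    [BorelSpace α] [T2Space α] [NormalSpace α] {G : Set α} (hG : IsCompact G) :
    IsCompact {γ : ProbabilityMeasure α | γ.toMeasure Gᶜ = 0} := by
  have h := isCompact_setOfPred_probabilityMeasure_mass_eq_compl_isCompact_le (E := α)
    (u := fun _ => 0) (K := fun _ => G) tendsto_const_nhds (fun _ => hG) (Or.inl inferInstance)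
  convert h using 3 with γ
  simp [ProbabilityMeasure.null_iff_toMeasure_null]

theorem measure_compl_eq_zero_of_mem_closure_convexCombos {α : Type*} [MeasurableSpace α]
    [TopologicalSpace α] [BorelSpace α] [T2Space α] [NormalSpace α]
    [T2Space (ProbabilityMeasure α)] {G : Set α} (hG : IsCompact G)
    {A : Set (ProbabilityMeasure α)} (h : ∀ γ ∈ A, γ.toMeasure Gᶜ = 0) :
    ∀ γ ∈ closure (convexCombos A), γ.toMeasure Gᶜ = 0 := by
  refine fun μ hμ => closure_minimal (fun μ hμ => ?_) (isCompact_concentrated hG).isClosed hμ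
  obtain ⟨m, w, γ, hγ, -, hμ⟩ := hμ
  simp [hμ, h _ (hγ _)]

/-- Sets contained in a fixed compact set which contain `W`, and all of whose cluster points
lie in `W`, converge to `W` in the Hausdorff distance. -/
theorem tendsto_hausdorffDist_of_isCompact {α ι : Type*} [t : TopologicalSpace α]
    (mα : MetricSpace α) (hm : mα.toPseudoMetricSpace.toUniformSpace.toTopologicalSpace = t)
    {l : Filter ι} {A : ι → Set α} {K W : Set α} (hK : IsCompact K)
    (hAK : ∀ᶠ i in l, A i ⊆ K) (hWA : ∀ᶠ i in l, W ⊆ A i)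
    (hlim : ∀ (i : ℕ → ι) (x : ℕ → α) (a : α), Tendsto i atTop l → (∀ k, x k ∈ A (i k)) →
      Tendsto x atTop (𝓝 a) → a ∈ W) [l.IsCountablyGenerated] :
    Tendsto (fun i => @Metric.hausdorffDist _ mα.toPseudoMetricSpace (A i) W) l (𝓝 0) := by
  subst hm
  refine Metric.tendsto_nhds.2 fun r hr => ?_
  have key : ∀ᶠ i in l, ∀ x ∈ A i, ∃ y ∈ W, dist x y ≤ r / 2 := by
    by_contra! hcon
    obtain ⟨i, hi, hx⟩ := exists_seq_forall_of_frequently (hcon.and_eventually hAK)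
    choose x hxA hxW using fun k => (hx k).1
    obtain ⟨a, -, φ, hφ, ha⟩ := hK.tendsto_subseq fun k => (hx k).2 (hxA k)
    have haW := hlim _ _ a (hi.comp hφ.tendsto_atTop) (fun k => hxA (φ k)) ha
    obtain ⟨k, hk⟩ := (Metric.tendsto_nhds.1 ha (r / 2) (half_pos hr)).exists
    exact (hxW _ _ haW).not_gt hk
  filter_upwards [key, hWA] with i hi hW
  rw [Real.dist_0_eq_abs, abs_of_nonneg Metric.hausdorffDist_nonneg]
  refine (Metric.hausdorffDist_le_of_mem_dist (half_pos hr).le hi fun y hy => ?_).trans_lt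
    (half_lt_self hr)
  exact ⟨y, hW hy, by simpa using (half_pos hr).le⟩

/-- A probability measure lies in the closed convex hull of `A` as soon as it cannot be
separated from `A` by a bounded continuous function. -/
theorem mem_closure_convexCombos {α : Type*} [MeasurableSpace α] [TopologicalSpace α]
    [OpensMeasurableSpace α] {A : Set (ProbabilityMeasure α)} {γ : ProbabilityMeasure α}
    (h : ∀ (q : BoundedContinuousFunction α ℝ) (δ : ℝ), 0 < δ →
      ∃ θ ∈ A, ∫ x, q x ∂θ.toMeasure ≤ ∫ x, q x ∂γ.toMeasure + δ) :
    γ ∈ closure (convexCombos A) := by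
  classical
  have key (s : Finset (BoundedContinuousFunction α ℝ)) (r : ℝ) (hr : 0 < r) :
      ∃ μ ∈ convexCombos A, ∀ q ∈ s,
        |∫ x, q x ∂μ.toMeasure - ∫ x, q x ∂γ.toMeasure| < r := by
    let L : ProbabilityMeasure α → s → ℝ := fun μ q => ∫ x, q.1 x ∂μ.toMeasure
    have hmem : L γ ∈ closure (convexHull ℝ (L '' A)) := by
      by_contra hcon
      obtain ⟨f, u, hfu, hu⟩ := geometric_hahn_banach_point_closed
        (convex_convexHull ℝ _).closure isClosed_closure hcon
      let q : BoundedContinuousFunction α ℝ := ∑ i : s, f (Pi.single i 1) • i.1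
      have hf (μ : ProbabilityMeasure α) : ∫ x, q x ∂μ.toMeasure = f (L μ) := by
        have h1 := f.toLinearMap.pi_apply_eq_sum_univ (L μ)
        have h2 : ∀ x, q x = ∑ i : s, f (Pi.single i 1) * i.1 x := fun x => by
          simp [q]
        simp_rw [h2]
        rw [integral_finsetSum _ fun i _ => (i.1.integrable μ.toMeasure).const_mul _]
        simp_rw [integral_const_mul]
        refine Eq.trans ?_ h1.symm
        refine Finset.sum_congr rfl fun i _ => ?_
        rw [smul_eq_mul, mul_comm]
        refine congrArg₂ (· * ·) rfl (congrArg f (funext fun j => ?_))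
        simp [Pi.single_apply, eq_comm]
      obtain ⟨θ, hθ, hle⟩ := h q ((u - f (L γ)) / 2) (by linarith)
      have := hu _ (subset_closure (subset_convexHull ℝ _ (mem_image_of_mem L hθ)))
      rw [hf, hf] at hle
      linarith
    obtain ⟨z, hz, hdist⟩ := Metric.mem_closure_iff.1 hmem r hr
    obtain ⟨ι, _, w, v, hw0, hw1, hv, hwz⟩ := mem_convexHull_iff_exists_fintype.1 hz
    choose θ hθA hθ using hv
    let e := (Fintype.equivFin ι).symm
    let w' : Fin (Fintype.card ι) → ℝ≥0 := fun i => ⟨w (e i), hw0 _⟩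
    have hw' : ∑ i, w' i = 1 := by
      rw [← NNReal.coe_inj]
      push_cast
      exact (e.sum_comp w).trans hw1
    have hprob : IsProbabilityMeasure
        (∑ i, (w' i : ℝ≥0∞) • (θ (e i)).toMeasure) := by
      constructor
      simp only [Measure.coe_finsetSum, Finset.sum_apply, Measure.smul_apply, measure_univ,
        smul_eq_mul, mul_one]
      exact_mod_cast hw'
    refine ⟨⟨_, hprob⟩, ⟨_, w', fun i => θ (e i), fun i => hθA _, hw', rfl⟩, fun q hq => ?_⟩
    have hz' : z ⟨q, hq⟩ = ∫ x, q x ∂(∑ i, (w' i : ℝ≥0∞) • (θ (e i)).toMeasure) := by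
      rw [integral_sum_smul, ← hwz, Finset.sum_apply, ← e.sum_comp]
      refine Finset.sum_congr rfl fun i _ => ?_
      rw [Pi.smul_apply, ← hθ]
      rfl
    have := (dist_le_pi_dist (L γ) z ⟨q, hq⟩).trans_lt hdist
    rw [dist_comm, Real.dist_eq, hz'] at this
    exact this
  have : Nonempty (ProbabilityMeasure α) := ⟨γ⟩
  choose! μ hμA hμ using key
  refine mem_closure_of_tendsto (b := (atTop : Filter (Finset (BoundedContinuousFunction α ℝ) × ℕ)))
    (f := fun p => μ p.1 (1 / ((p.2 : ℝ) + 1))) ?_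
    (.of_forall fun p => hμA _ _ (by positivity))
  refine ProbabilityMeasure.tendsto_iff_forall_integral_tendsto.2 fun q =>
    Metric.tendsto_nhds.2 fun r hr => ?_
  obtain ⟨k, hk⟩ := exists_nat_one_div_lt hr
  filter_upwards [eventually_ge_atTop (({q} : Finset (BoundedContinuousFunction α ℝ)), k)]
    with p hp
  refine (hμ p.1 _ (by positivity) q (hp.1 (by simp))).trans (lt_of_le_of_lt ?_ hk)
  have : (k : ℝ) ≤ p.2 := by exact_mod_cast hp.2
  gcongr

/-- A measurable selection does at least as well as a randomised one: for a measure `γ`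
concentrated on the graph, some feasible feedback control has cost at most `∫ J ∂γ`. -/
theorem exists_selection_integral_le (M : Model n Uc S) {γ : Measure ((Fin n → ℝ) × Uc)}
    [IsProbabilityMeasure γ] (hγ : γ (graphG M)ᶜ = 0) {J : (Fin n → ℝ) × Uc → ℝ}
    (hJ : Measurable J) {C : ℝ} (hC : ∀ p, |J p| ≤ C) :
    ∃ g : (Fin n → ℝ) → Uc, Measurable g ∧ (∀ y ∈ M.Y, g y ∈ M.U y) ∧
      ∫ y, J (y, g y) ∂γ.fst ≤ ∫ p, J p ∂γ := by
  classical
  have := M.nonempty_control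
  obtain ⟨σ, hσ, hσU⟩ := M.exists_selection
  obtain ⟨F, hF, hFγ⟩ := γ.condKernel.exists_measurable_map_eq_unitInterval
  have hΦ : Measurable fun r : (Fin n → ℝ) × unitInterval => (r.1, F r.1 r.2) :=
    measurable_fst.prodMk hF
  have hmap : (γ.fst.prod volume).map
      (fun r : (Fin n → ℝ) × unitInterval => (r.1, F r.1 r.2)) = γ := by
    conv_rhs => rw [← γ.disintegrate γ.condKernel]
    ext s hs
    rw [Measure.map_apply hΦ hs, Measure.prod_apply (hΦ hs), Measure.compProd_apply hs]
    refine lintegral_congr fun y => ?_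
    have hs' : MeasurableSet (Prod.mk y ⁻¹' s) := measurable_prodMk_left hs
    rw [← hFγ y, Measure.map_apply (f := F y) (hF.comp measurable_prodMk_left) hs']
    rfl
  let F' : unitInterval → (Fin n → ℝ) → Uc := fun ω y =>
    if (y, F y ω) ∈ graphG M then F y ω else σ y
  have hF' : Measurable fun r : (Fin n → ℝ) × unitInterval => F' r.2 r.1 :=
    Measurable.ite (hΦ M.measurableSet_graphG) hF (hσ.comp measurable_fst)
  have hae : ∀ᵐ r ∂γ.fst.prod (volume : Measure unitInterval), F' r.2 r.1 = F r.1 r.2 := by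
    have h : ∀ᵐ p ∂γ, p ∈ graphG M := hγ
    rw [← hmap] at h
    exact (ae_of_ae_map hΦ.aemeasurable h).mono fun r hr => if_pos hr
  have hJF : Measurable fun r : (Fin n → ℝ) × unitInterval => J (r.1, F' r.2 r.1) :=
    hJ.comp (measurable_fst.prodMk hF')
  have hint : Integrable (fun r : (Fin n → ℝ) × unitInterval => J (r.1, F' r.2 r.1))
      (γ.fst.prod volume) :=
    .of_bound hJF.aestronglyMeasurable C (.of_forall fun r => hC _)
  have hval : ∫ ω, ∫ y, J (y, F' ω y) ∂γ.fst ∂(volume : Measure unitInterval) =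
      ∫ p, J p ∂γ := by
    rw [← integral_prod_symm _ hint]
    conv_rhs => rw [← hmap, integral_map hΦ.aemeasurable hJ.aestronglyMeasurable]
    exact integral_congr_ae (hae.mono fun r hr => by simp only [hr])
  obtain ⟨ω, hω⟩ := exists_le_integral hint.integral_prod_right
  refine ⟨F' ω, hF'.comp measurable_prodMk_right, fun y hy => ?_, hω.trans_eq hval⟩
  simp only [F']
  split_ifs with h
  · exact h.2
  · exact hσU y hy

theorem integral_step_comp (M : Model n Uc S) (γ : Measure ((Fin n → ℝ) × Uc))
    [IsProbabilityMeasure γ] {φ : (Fin n → ℝ) → ℝ} (hφ : Measurable φ) {C : ℝ}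
    (hC : ∀ y, |φ y| ≤ C) :
    ∫ z, φ z ∂(M.step ∘ₘ γ) = ∫ p, ∫ z, φ z ∂M.step p ∂γ := by
  have h := Kernel.integral_comp (η := M.step) (κ := Kernel.const Unit γ) (a := ()) (f := φ)
    (.of_bound hφ.aestronglyMeasurable C (.of_forall hC))
  rwa [Kernel.comp_apply, Kernel.const_apply] at h

/-- The first marginal of a stationary measure is invariant under the controlled dynamics. -/
theorem step_comp_of_mem_Wset (M : Model n Uc S) {γ : Measure ((Fin n → ℝ) × Uc)}
    (hγ : γ ∈ Wset M) : M.step ∘ₘ γ = γ.fst := by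
  have := hγ.1
  refine ext_of_forall_integral_eq_of_IsFiniteMeasure fun ψ => ?_
  have hψ : Measurable ψ := ψ.continuous.measurable
  have h := integral_generator_of_mem_Wset M hγ ψ
  rw [integral_sub, sub_eq_zero] at h
  · rw [integral_step_comp M γ hψ ψ.norm_coe_le_norm, h, Measure.fst,
      integral_map measurable_fst.aemeasurable hψ.aestronglyMeasurable]
  · refine .of_bound (C := ‖ψ‖) (StronglyMeasurable.integral_kernel
      hψ.stronglyMeasurable).aestronglyMeasurable (.of_forall fun p => ?_)
    simpa using norm_integral_le_of_norm_le_const (μ := M.step p)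
      (.of_forall ψ.norm_coe_le_norm)
  · exact .of_bound (hψ.comp measurable_fst).aestronglyMeasurable ‖ψ‖
      (.of_forall fun p => ψ.norm_coe_le_norm _)

namespace Plan

variable {M : Model n Uc S}

/-- The expected cost, discounted by `β`, over the first `N` time steps. -/
def partialCost (β : ℝ) (q : (Fin n → ℝ) × Uc → ℝ) (N : ℕ) (π : Plan M) (y : Fin n → ℝ) : ℝ :=
  ∑ t ∈ Finset.range N, β ^ t * expect q t π y

theorem measurable_partialCost (β : ℝ) {q : (Fin n → ℝ) × Uc → ℝ} (hq : Measurable q)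
    (N : ℕ) (π : Plan M) : Measurable (partialCost β q N π) :=
  Finset.measurable_fun_sum _ fun t _ => (measurable_expect hq t π).const_mul _

theorem abs_partialCost_le {β : ℝ} (hβ : 0 ≤ β) {q : (Fin n → ℝ) × Uc → ℝ} {C : ℝ}
    (hC : ∀ p, |q p| ≤ C) (N : ℕ) (π : Plan M) (y : Fin n → ℝ) :
    |partialCost β q N π y| ≤ ∑ t ∈ Finset.range N, β ^ t * C := by
  refine (Finset.abs_sum_le_sum_abs _ _).trans (Finset.sum_le_sum fun t _ => ?_)
  rw [abs_mul, abs_of_nonneg (pow_nonneg hβ t)]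
  gcongr
  exact abs_expect_le hC t π y

theorem partialCost_cons_succ (β : ℝ) {q : (Fin n → ℝ) × Uc → ℝ} (hq : Measurable q) {C : ℝ}
    (hC : ∀ p, |q p| ≤ C) (N : ℕ) (π : Plan M) {g : (Fin n → ℝ) → Uc} (hg : Measurable g)
    (hgU : ∀ y ∈ M.Y, g y ∈ M.U y) (y : Fin n → ℝ) :
    partialCost β q (N + 1) (π.cons_s3 hg hgU) y =
      q (y, g y) + β * ∫ z, partialCost β q N π z ∂M.step (y, g y) := by
  have hshift : (π.cons_s3 hg hgU).shift = π := rfl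
  have hact : (π.cons_s3 hg hgU).act 0 y = (y, g y) := rfl
  simp only [partialCost]
  rw [Finset.sum_range_succ', expect_zero hq, integral_finsetSum, Finset.mul_sum, add_comm]
  · congr 1
    · simp [hact]
    · refine Finset.sum_congr rfl fun t _ => ?_
      rw [expect_succ hq hC, hshift, hact, integral_const_mul, pow_succ']
      ring
  · intro t _
    exact (Integrable.of_bound (measurable_expect hq t π).aestronglyMeasurable C
      (.of_forall fun z => abs_expect_le hC t π z)).const_mul _

theorem exists_integral_partialCost_le {γ : Measure ((Fin n → ℝ) × Uc)} (hγ : γ ∈ Wset M)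
    {β : ℝ} (hβ : 0 ≤ β) {q : (Fin n → ℝ) × Uc → ℝ} (hq : Measurable q) {C : ℝ}
    (hC : ∀ p, |q p| ≤ C) (N : ℕ) :
    ∃ π : Plan M, ∫ y, partialCost β q N π y ∂γ.fst ≤
      (∑ t ∈ Finset.range N, β ^ t) * ∫ p, q p ∂γ := by
  have := hγ.1
  induction N with
  | zero => exact ⟨Classical.arbitrary _, by simp [partialCost]⟩
  | succ N ih =>
    obtain ⟨π, hπ⟩ := ih
    have hpm := measurable_partialCost β hq N π
    have hpb := abs_partialCost_le hβ hC N π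
    let H : (Fin n → ℝ) × Uc → ℝ := fun p => ∫ z, partialCost β q N π z ∂M.step p
    have hHm : Measurable H :=
      (StronglyMeasurable.integral_kernel hpm.stronglyMeasurable).measurable
    have hHb (p) : |H p| ≤ ∑ t ∈ Finset.range N, β ^ t * C := by
      simpa using norm_integral_le_of_norm_le_const (μ := M.step p)
        (f := partialCost β q N π) (.of_forall hpb)
    obtain ⟨g, hg, hgU, hle⟩ := exists_selection_integral_le M hγ.2.1
      (J := fun p => q p + β * H p) (hq.add (hHm.const_mul β))
      (C := C + β * ∑ t ∈ Finset.range N, β ^ t * C) (fun p => by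
        refine (abs_add_le _ _).trans ?_
        rw [abs_mul, abs_of_nonneg hβ]
        gcongr
        exacts [hC p, hHb p])
    refine ⟨π.cons_s3 hg hgU, ?_⟩
    simp_rw [partialCost_cons_succ β hq hC]
    refine hle.trans ?_
    rw [integral_add (.of_bound hq.aestronglyMeasurable C (.of_forall hC))
      ((Integrable.of_bound hHm.aestronglyMeasurable _ (.of_forall hHb)).const_mul _),
      integral_const_mul, ← integral_step_comp M γ hpm hpb, step_comp_of_mem_Wset M hγ,
      geom_sum_succ]
    nlinarith

theorem exists_integral_discOcc_le {γ : Measure ((Fin n → ℝ) × Uc)} (hγ : γ ∈ Wset M)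
    {ε : ℝ} (hε : ε ∈ Ioo (0 : ℝ) 1) (q : BoundedContinuousFunction ((Fin n → ℝ) × Uc) ℝ)
    {δ : ℝ} (hδ : 0 < δ) :
    ∃ π : Plan M, ∃ y ∈ M.Y, ∫ p, q p ∂discOcc M ε π.π y ≤ ∫ p, q p ∂γ + δ := by
  have := hγ.1
  have hβ₀ : 0 ≤ 1 - ε := by linarith [hε.2]
  have hβ₁ : 1 - ε < 1 := by linarith [hε.1]
  have hlim : Tendsto (fun N : ℕ => (1 - ε) ^ N * (2 * ‖q‖)) atTop (𝓝 0) := by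
    simpa using (tendsto_pow_atTop_nhds_zero_of_lt_one hβ₀ hβ₁).mul_const (2 * ‖q‖)
  obtain ⟨N, hN⟩ := (hlim.eventually_lt_const hδ).exists
  have hq : Measurable q := q.continuous.measurable
  obtain ⟨π, hπ⟩ := exists_integral_partialCost_le hγ hβ₀ hq q.norm_coe_le_norm N
  have hY : γ.fst M.Yᶜ = 0 := by
    rw [Measure.fst_apply M.measurableSet_Y.compl]
    exact measure_mono_null (t := (graphG M)ᶜ) (fun p hp hG => hp hG.1) hγ.2.1
  obtain ⟨y, hy, hle⟩ := exists_notMem_null_le_integral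
    (.of_bound (measurable_partialCost (1 - ε) hq N π).aestronglyMeasurable _
      (.of_forall (abs_partialCost_le hβ₀ q.norm_coe_le_norm N π))) hY
  rw [notMem_compl_iff] at hy
  refine ⟨π, y, hy, ?_⟩
  have htail := (hasSum_nat_add_iff' N).2 (hasSum_discOcc hε π hy q)
  have hgeom : HasSum (fun t => ε * ((1 - ε) ^ (t + N) * ‖q‖)) ((1 - ε) ^ N * ‖q‖) := by
    have h := (hasSum_geometric_of_lt_one hβ₀ hβ₁).mul_left (ε * (1 - ε) ^ N * ‖q‖)
    have hv : ε * (1 - ε) ^ N * ‖q‖ * (1 - (1 - ε))⁻¹ = (1 - ε) ^ N * ‖q‖ := by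
      rw [sub_sub_cancel]
      field_simp [hε.1.ne']
    rw [hv] at h
    refine h.congr_fun fun t => ?_
    ring
  have htail_le := hasSum_le (fun t => by
    gcongr
    · exact hε.1.le
    · exact (le_abs_self _).trans (abs_expect_le q.norm_coe_le_norm _ π y)) htail hgeom
  have hpart : ∑ t ∈ Finset.range N, ε * ((1 - ε) ^ t * expect q t π y) =
      ε * partialCost (1 - ε) q N π y := by rw [partialCost, Finset.mul_sum]
  have hsum : ε * ∑ t ∈ Finset.range N, (1 - ε) ^ t = 1 - (1 - ε) ^ N := by
    have := mul_neg_geom_sum (1 - ε) N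
    rwa [sub_sub_cancel] at this
  have hmain : ε * partialCost (1 - ε) q N π y ≤ (1 - (1 - ε) ^ N) * ∫ p, q p ∂γ := by
    rw [← hsum, mul_assoc]
    exact mul_le_mul_of_nonneg_left (hle.trans hπ) hε.1.le
  have hqγ : -‖q‖ ≤ ∫ p, q p ∂γ := by
    have := norm_integral_le_of_norm_le_const (μ := γ) (.of_forall q.norm_coe_le_norm)
    exact (abs_le.1 (by simpa using this)).1
  rw [hpart] at htail_le
  nlinarith [pow_nonneg hβ₀ N]

end Plan

theorem ThetaEpsAll_concentrated (M : Model n Uc S) (ε : ℝ) :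
    ∀ θ ∈ ThetaEpsAll M ε, θ.toMeasure (graphG M)ᶜ = 0 := by
  intro θ hθ
  obtain ⟨y, hy, π, hπ⟩ := mem_iUnion₂.1 hθ
  rw [hπ]
  exact Plan.discOcc_compl ε π hy

theorem abs_integral_generator_ThetaEpsAll_le (M : Model n Uc S) {ε : ℝ}
    (hε : ε ∈ Ioo (0 : ℝ) 1) (ψ : BoundedContinuousFunction (Fin n → ℝ) ℝ)
    {Q : BoundedContinuousFunction ((Fin n → ℝ) × Uc) ℝ}
    (hQ : ∀ p ∈ graphG M, Q p = ∫ z, ψ z ∂M.step p - ψ p.1) :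
    ∀ θ ∈ ThetaEpsAll M ε, |∫ p, Q p ∂θ.toMeasure| ≤ 2 * ε * ‖ψ‖ := by
  intro θ hθ
  obtain ⟨y, hy, π, hπ⟩ := mem_iUnion₂.1 hθ
  rw [hπ]
  exact Plan.abs_integral_generator_discOcc_le hε π hy ψ hQ

theorem WsetPM_subset_closure_convexCombos (M : Model n Uc S) {ε : ℝ}
    (hε : ε ∈ Ioo (0 : ℝ) 1) : WsetPM M ⊆ closure (convexCombos (ThetaEpsAll M ε)) := by
  refine fun γ hγ => mem_closure_convexCombos fun q δ hδ => ?_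
  obtain ⟨π, y, hy, hle⟩ := Plan.exists_integral_discOcc_le hγ hε q hδ
  exact ⟨⟨_, Plan.isProbabilityMeasure_discOcc hε π hy⟩, mem_iUnion₂.2 ⟨y, hy, π, rfl⟩, hle⟩

theorem mem_WsetPM_of_tendsto (M : Model n Uc S) {ε : ℕ → ℝ}
    (hε : Tendsto ε atTop (𝓝[Ioo (0 : ℝ) 1] 0))
    {γ : ℕ → ProbabilityMeasure ((Fin n → ℝ) × Uc)} {γ₀ : ProbabilityMeasure ((Fin n → ℝ) × Uc)}
    (hγ : ∀ k, γ k ∈ closure (convexCombos (ThetaEpsAll M (ε k))))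
    (hlim : Tendsto γ atTop (𝓝 γ₀)) : γ₀ ∈ WsetPM M := by
  obtain ⟨hε₀, hεI⟩ := tendsto_nhdsWithin_iff.1 hε
  have hcon : γ₀.toMeasure (graphG M)ᶜ = 0 :=
    (isCompact_concentrated M.isCompact_graphG).isClosed.mem_of_tendsto hlim
      (.of_forall fun k => measure_compl_eq_zero_of_mem_closure_convexCombos M.isCompact_graphG
        (ThetaEpsAll_concentrated M (ε k)) _ (hγ k))
  refine mem_WsetPM_of_integral_generator M hcon fun ψ => ?_
  obtain ⟨Q, hQ⟩ := M.exists_generator_extension ψ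
  have hG : ∀ᵐ p ∂γ₀.toMeasure, p ∈ graphG M := hcon
  rw [← integral_congr_ae (hG.mono hQ)]
  have h₁ := ProbabilityMeasure.tendsto_iff_forall_integral_tendsto.1 hlim Q
  have h₂ : Tendsto (fun k => 2 * ε k * ‖ψ‖) atTop (𝓝 0) := by
    simpa using (hε₀.const_mul 2).mul_const ‖ψ‖
  refine tendsto_nhds_unique h₁ (squeeze_zero_norm' ?_ h₂)
  filter_upwards [hεI] with k hk
  exact abs_integral_le_of_mem_closure_convexCombos
    (abs_integral_generator_ThetaEpsAll_le M hk ψ hQ) _ (hγ k)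

/-- `lim_{ε→0} ρ_H( cl co Θ_ε , W ) = 0`, where `Θ_ε = ∪_{y₀∈Y} Θ_ε(y₀)` and
`ρ_H` is the Hausdorff (semi)metric associated with any metric on the space of probability
measures on `G` that metrizes the weak* topology. -/
theorem statement3 (M : Model n Uc S)
    (mρ : MetricSpace (ProbabilityMeasure ((Fin n → ℝ) × Uc)))
    (hmρ : mρ.toPseudoMetricSpace.toUniformSpace.toTopologicalSpace =
      (inferInstance : TopologicalSpace (ProbabilityMeasure ((Fin n → ℝ) × Uc)))) :
    Tendsto (fun ε : ℝ =>
        @Metric.hausdorffDist _ mρ.toPseudoMetricSpace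
          (closure (convexCombos (ThetaEpsAll M ε))) (WsetPM M))
      (𝓝[Set.Ioo (0 : ℝ) 1] 0) (𝓝 0) := by
  refine tendsto_hausdorffDist_of_isCompact mρ hmρ
    (isCompact_concentrated M.isCompact_graphG) ?_ ?_ fun ε γ γ₀ hε hγ hlim =>
      mem_WsetPM_of_tendsto M hε hγ hlim
  · exact .of_forall fun ε => measure_compl_eq_zero_of_mem_closure_convexCombos
      M.isCompact_graphG (ThetaEpsAll_concentrated M ε)
  · exact eventually_mem_nhdsWithin.mono fun ε => WsetPM_subset_closure_convexCombos M

end StochLP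
end
end
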